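/- Let m ≥ 1 be an integer, D = 𝕋 × (-1,1), and α a multi-index with |α| = m. There exists C = C(m) > 0 such that for all u, v ∈ H^m(D): ‖∂^α(uv) - u∂^α v‖_{L²(D)} ≤ C(‖Du‖_{L^∞} ‖∂^{m-1}v‖_{L²} + ‖∂^m u‖_{L²} ‖v‖_{L^∞} + ‖Du‖_{L^∞} ‖v‖_{L^∞}), where ‖∂^j w‖ denotes the sum of L² norms of all partial derivatives of order j. -/

import Mathlib

open Real MeasureTheory

/-- Iterated partial derivative `∂₁^k ∂₂^l f` on `ℝ²`. -/
noncomputable def pder (k l : ℕ) (f : ℝ × ℝ → ℝ) : ℝ × ℝ → ℝ :=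
  fun p => iteratedDeriv k (fun x₁ => iteratedDeriv l (fun x₂ => f (x₁, x₂)) p.2) p.1

/-- The channel `D = 𝕋 × (-1,1)` (one period in `x₁`). -/
def channelD : Set (ℝ × ℝ) := Set.Ioc (0 : ℝ) (2 * Real.pi) ×ˢ Set.Ioo (-1 : ℝ) 1

/-- An approximately log-convex sequence satisfies a one-step interpolation inequality. -/
lemma logConvex_step (C : ℝ) (hC : 0 ≤ C) (j : ℕ) : ∃ K : ℝ, 0 ≤ K ∧ ∀ (N : ℕ) (b : ℕ → ℝ),
    (∀ i, 0 ≤ b i) → (∀ i, i + 1 < N → b (i + 1) ^ 2 ≤ C * b i * b (i + 2)) →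
    j < N → b j ^ (j + 1) ≤ K * b 0 * b (j + 1) ^ j := by
  induction j with
  | zero => exact ⟨1, zero_le_one, fun N b _ _ _ => by simp⟩
  | succ j ih =>
    obtain ⟨K, hK, ih⟩ := ih
    refine ⟨C ^ (j + 1) * K, by positivity, fun N b hb hlog hj => ?_⟩
    have h0 := hb 0
    have h1 := hb (j + 1)
    have h2 := hb (j + 2)
    rcases h1.eq_or_lt with hz | hpos
    · rw [← hz, zero_pow (by omega)]; positivity
    · have key : b (j + 1) ^ (j + 1 + 1) * b (j + 1) ^ j
          ≤ C ^ (j + 1) * K * b 0 * b (j + 1 + 1) ^ (j + 1) * b (j + 1) ^ j := by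
        calc b (j + 1) ^ (j + 1 + 1) * b (j + 1) ^ j = (b (j + 1) ^ 2) ^ (j + 1) := by ring
          _ ≤ (C * b j * b (j + 2)) ^ (j + 1) := by gcongr; exact hlog j hj
          _ = C ^ (j + 1) * b (j + 2) ^ (j + 1) * b j ^ (j + 1) := by ring
          _ ≤ C ^ (j + 1) * b (j + 2) ^ (j + 1) * (K * b 0 * b (j + 1) ^ j) := by
            gcongr; exact ih N b hb hlog (by omega)
          _ = _ := by ring
      exact le_of_mul_le_mul_right key (by positivity)

/-- Interpolation for approximately log-convex sequences. -/
lemma logConvex_interp (C : ℝ) (hC : 0 ≤ C) (N i : ℕ) : ∃ K : ℝ, 0 ≤ K ∧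
    ∀ (b : ℕ → ℝ) (j : ℕ), (∀ i, 0 ≤ b i) →
    (∀ i, i + 1 < N → b (i + 1) ^ 2 ≤ C * b i * b (i + 2)) →
    j + i = N → b j ^ N ≤ K * b 0 ^ i * b N ^ j := by
  induction i with
  | zero =>
    refine ⟨1, zero_le_one, fun b j _ _ h => ?_⟩
    obtain rfl : j = N := by omega
    simp
  | succ i ih =>
    obtain ⟨L, hL, ih⟩ := ih
    by_cases hi : i + 1 ≤ N
    swap
    · exact ⟨0, le_rfl, fun b j _ _ h => by omega⟩
    obtain ⟨j, hj⟩ : ∃ j, j + (i + 1) = N := ⟨N - (i + 1), by omega⟩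
    obtain ⟨K, hK, hstep⟩ := logConvex_step C hC j
    set M : ℝ := max 1 (K ^ N * L ^ j)
    have hM1 : 1 ≤ M := le_max_left _ _
    have hM2 : K ^ N * L ^ j ≤ M := le_max_right _ _
    refine ⟨M, by positivity, fun b j' hb hlog h => ?_⟩
    obtain rfl : j' = j := by omega
    have h0 := hb 0
    have hN := hb N
    have hj0 := hb j'
    have hj1 := hb (j' + 1)
    refine le_of_pow_le_pow_left₀ (n := j' + 1) (by omega) (by positivity) ?_
    calc (b j' ^ N) ^ (j' + 1) = (b j' ^ (j' + 1)) ^ N := by ring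
      _ ≤ (K * b 0 * b (j' + 1) ^ j') ^ N := by
        gcongr; exact hstep N b hb hlog (by omega)
      _ = K ^ N * b 0 ^ N * (b (j' + 1) ^ N) ^ j' := by ring
      _ ≤ K ^ N * b 0 ^ N * (L * b 0 ^ i * b N ^ (j' + 1)) ^ j' := by
        gcongr; exact ih b (j' + 1) hb hlog (by omega)
      _ = (K ^ N * L ^ j') * (b 0 ^ N * b 0 ^ (i * j') * b N ^ ((j' + 1) * j')) := by ring
      _ ≤ M ^ (j' + 1) * (b 0 ^ N * b 0 ^ (i * j') * b N ^ ((j' + 1) * j')) := by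
        gcongr; exact hM2.trans (le_self_pow₀ hM1 (by omega))
      _ = (M * b 0 ^ (i + 1) * b N ^ j') ^ (j' + 1) := by
        rw [← hj]; ring

/-- The last term of an approximately log-convex monotone sequence is controlled by the first
term and the last increment. -/
lemma logConvex_last (C : ℝ) (hC : 0 ≤ C) (n : ℕ) : ∃ K : ℝ, 0 ≤ K ∧ ∀ b : ℕ → ℝ,
    (∀ i, 0 ≤ b i) → Monotone b →
    (∀ i, i + 1 < n + 1 → b (i + 1) ^ 2 ≤ C * b i * b (i + 2)) →
    b (n + 1) ≤ K * (b 0 + (b (n + 1) - b n)) := by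
  obtain ⟨L, hL, h⟩ := logConvex_step C hC n
  refine ⟨2 + 2 * (L * 2 ^ n), by positivity, fun b hb hmono hlog => ?_⟩
  have h0 := hb 0
  have hinc : 0 ≤ b (n + 1) - b n := sub_nonneg.2 (hmono n.le_succ)
  have hLn : 0 ≤ L * 2 ^ n := by positivity
  by_cases hc : b n ≤ b (n + 1) - b n
  · nlinarith [mul_nonneg hLn h0, mul_nonneg hLn hinc]
  · push Not at hc
    have hpos : 0 < b n := hinc.trans_lt hc
    have h1 : b n * b n ^ n ≤ L * 2 ^ n * b 0 * b n ^ n := by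
      calc b n * b n ^ n = b n ^ (n + 1) := by ring
        _ ≤ L * b 0 * b (n + 1) ^ n := h (n + 1) b hb hlog (by omega)
        _ ≤ L * b 0 * (2 * b n) ^ n := by
          have := hb (n + 1)
          gcongr; linarith
        _ = _ := by ring
    have h2 : b n ≤ L * 2 ^ n * b 0 := le_of_mul_le_mul_right h1 (by positivity)
    nlinarith [mul_nonneg hLn h0, mul_nonneg hLn hinc]

lemma hasDerivAt_abs_rpow_mul_self {s : ℝ} (hs : 0 < s) (x : ℝ) :
    HasDerivAt (fun x : ℝ => |x| ^ s * x) ((s + 1) * |x| ^ s) x := by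
  rcases eq_or_ne x 0 with rfl | hx
  · rw [hasDerivAt_iff_tendsto_slope]
    have hc : Continuous fun x : ℝ => |x| ^ s :=
      continuous_abs.rpow_const fun _ => Or.inr hs.le
    have := (hc.tendsto 0).mono_left (nhdsWithin_le_nhds (s := {(0 : ℝ)}ᶜ))
    simp only [abs_zero, Real.zero_rpow hs.ne'] at this
    simp only [abs_zero, Real.zero_rpow hs.ne', mul_zero]
    refine this.congr' ?_
    filter_upwards [self_mem_nhdsWithin] with y hy
    have hy : y ≠ 0 := hy
    simp [slope_def_field, hy]
  · have h1 : HasDerivAt (fun x : ℝ => |x| ^ s) (s * |x| ^ (s - 1) * SignType.sign x) x := by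
      have := (hasDerivAt_abs hx).rpow_const (p := s) (Or.inl (abs_ne_zero.2 hx))
      convert this using 1; ring
    have := h1.mul (hasDerivAt_id x)
    refine this.congr_deriv ?_
    have h2 : |x| ^ s = |x| ^ (s - 1) * |x| := by
      rw [← Real.rpow_add_one (abs_ne_zero.2 hx)]; simp
    have h3 : (SignType.sign x : ℝ) * x = |x| := sign_mul_self x
    simp only [id]
    rw [h2, ← h3]; ring

/-- Integration by parts for the integral of `|∂g|^(s+2)`. -/
lemma integral_abs_deriv_rpow {s l : ℝ} (hs : 0 < s) {g g₁ g₂ : ℝ → ℝ}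
    (hg : ∀ t, HasDerivAt g (g₁ t) t) (hg₁ : ∀ t, HasDerivAt g₁ (g₂ t) t)
    (hg₂ : Continuous g₂) :
    ∫ t in (0 : ℝ)..l, |g₁ t| ^ (s + 2) =
      g l * (|g₁ l| ^ s * g₁ l) - g 0 * (|g₁ 0| ^ s * g₁ 0)
        - (s + 1) * ∫ t in (0 : ℝ)..l, g t * |g₁ t| ^ s * g₂ t := by
  have cg : Continuous g := continuous_iff_continuousAt.2 fun t => (hg t).continuousAt
  have cg₁ : Continuous g₁ := continuous_iff_continuousAt.2 fun t => (hg₁ t).continuousAt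
  have ca : Continuous fun t => |g₁ t| ^ s := cg₁.abs.rpow_const fun _ => Or.inr hs.le
  have hΦ : ∀ t, HasDerivAt (fun t => |g₁ t| ^ s * g₁ t) ((s + 1) * |g₁ t| ^ s * g₂ t) t :=
    fun t => (hasDerivAt_abs_rpow_mul_self hs (g₁ t)).comp t (hg₁ t)
  have := intervalIntegral.integral_deriv_mul_eq_sub (a := 0) (b := l)
    (fun t _ => hg t) (fun t _ => hΦ t) (cg₁.intervalIntegrable _ _)
    (((continuous_const.mul ca).mul hg₂).intervalIntegrable _ _)
  have c1 : Continuous fun t => g₁ t * (|g₁ t| ^ s * g₁ t) := by fun_prop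
  have c2 : Continuous fun t => g t * ((s + 1) * |g₁ t| ^ s * g₂ t) := by fun_prop
  rw [intervalIntegral.integral_add (c1.intervalIntegrable _ _)
    (c2.intervalIntegrable _ _)] at this
  have e1 : ∀ t, g₁ t * (|g₁ t| ^ s * g₁ t) = |g₁ t| ^ (s + 2) := fun t => by
    rw [Real.rpow_add_of_nonneg (abs_nonneg _) hs.le zero_le_two, Real.rpow_two, sq_abs]; ring
  have e2 : ∀ t, g t * ((s + 1) * |g₁ t| ^ s * g₂ t) = (s + 1) * (g t * |g₁ t| ^ s * g₂ t) :=
    fun t => by ring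
  simp only [e1, e2, intervalIntegral.integral_const_mul] at this
  linarith

/-- Two functions whose boundary terms cancel: an interpolation inequality without lower order
terms. -/
lemma integral_abs_deriv_rpow_le {s l : ℝ} (hs : 0 < s) (hl : 0 < l) {g g₁ g₂ k k₁ k₂ : ℝ → ℝ}
    (hg : ∀ t, HasDerivAt g (g₁ t) t) (hg₁ : ∀ t, HasDerivAt g₁ (g₂ t) t) (hg₂ : Continuous g₂)
    (hk : ∀ t, HasDerivAt k (k₁ t) t) (hk₁ : ∀ t, HasDerivAt k₁ (k₂ t) t) (hk₂ : Continuous k₂)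
    (hgl : g l = 0) (hkl : k l = 0) (h0 : k 0 = g 0) (h1 : k₁ 0 = - g₁ 0) :
    ∫ t in Set.Ioo 0 l, |g₁ t| ^ (s + 2) ≤
      (s + 1) * ∫ t in Set.Ioo 0 l, (|g t| * |g₁ t| ^ s * |g₂ t| + |k t| * |k₁ t| ^ s * |k₂ t|) := by
  have cg : Continuous g := continuous_iff_continuousAt.2 fun t => (hg t).continuousAt
  have cg₁ : Continuous g₁ := continuous_iff_continuousAt.2 fun t => (hg₁ t).continuousAt
  have ck : Continuous k := continuous_iff_continuousAt.2 fun t => (hk t).continuousAt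
  have ck₁ : Continuous k₁ := continuous_iff_continuousAt.2 fun t => (hk₁ t).continuousAt
  have cga : Continuous fun t => |g₁ t| ^ s := cg₁.abs.rpow_const fun _ => Or.inr hs.le
  have cka : Continuous fun t => |k₁ t| ^ s := ck₁.abs.rpow_const fun _ => Or.inr hs.le
  simp only [← integral_Ioc_eq_integral_Ioo, ← intervalIntegral.integral_of_le hl.le]
  have eg := integral_abs_deriv_rpow (l := l) hs hg hg₁ hg₂
  have ek := integral_abs_deriv_rpow (l := l) hs hk hk₁ hk₂
  rw [hgl] at eg
  rw [hkl, h0, h1, abs_neg] at ek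
  have hkpos : 0 ≤ ∫ t in (0 : ℝ)..l, |k₁ t| ^ (s + 2) :=
    intervalIntegral.integral_nonneg hl.le fun t _ => by positivity
  have hsum : -∫ t in (0 : ℝ)..l, (g t * |g₁ t| ^ s * g₂ t + k t * |k₁ t| ^ s * k₂ t) ≤
      ∫ t in (0 : ℝ)..l, (|g t| * |g₁ t| ^ s * |g₂ t| + |k t| * |k₁ t| ^ s * |k₂ t|) := by
    rw [← intervalIntegral.integral_neg]
    refine intervalIntegral.integral_mono_on hl.le (Continuous.intervalIntegrable ?_ _ _)
      (Continuous.intervalIntegrable ?_ _ _) fun t _ => ?_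
    · fun_prop
    · fun_prop
    · have a1 : -(g t * |g₁ t| ^ s * g₂ t) ≤ |g t| * |g₁ t| ^ s * |g₂ t| :=
        (neg_le_abs _).trans_eq (by
          rw [abs_mul, abs_mul, abs_of_nonneg (by positivity : 0 ≤ |g₁ t| ^ s)])
      have a2 : -(k t * |k₁ t| ^ s * k₂ t) ≤ |k t| * |k₁ t| ^ s * |k₂ t| :=
        (neg_le_abs _).trans_eq (by
          rw [abs_mul, abs_mul, abs_of_nonneg (by positivity : 0 ≤ |k₁ t| ^ s)])
      linarith
  have c1 : Continuous fun t => g t * |g₁ t| ^ s * g₂ t := by fun_prop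
  have c2 : Continuous fun t => k t * |k₁ t| ^ s * k₂ t := by fun_prop
  rw [intervalIntegral.integral_add (c1.intervalIntegrable _ _)
    (c2.intervalIntegrable _ _)] at hsum
  have := mul_le_mul_of_nonneg_left hsum (by linarith : 0 ≤ s + 1)
  linarith

lemma memLp_of_continuous_bounded {S : Set (ℝ × ℝ)} (hS : Bornology.IsBounded S)
    (hm : MeasurableSet S) {f : ℝ × ℝ → ℝ} (hf : Continuous f) (s : ENNReal) :
    MemLp f s (volume.restrict S) := by
  have : IsFiniteMeasure (volume.restrict S) := ⟨by simpa using hS.measure_lt_top⟩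
  obtain ⟨B, hB⟩ := hS.isCompact_closure.exists_bound_of_continuousOn hf.continuousOn
  refine MemLp.of_bound hf.aestronglyMeasurable B ?_
  filter_upwards [ae_restrict_mem hm] with x hx
  exact hB x (subset_closure hx)

lemma lpNorm_le_mul_of_abs_le {S : Set (ℝ × ℝ)} (hS : Bornology.IsBounded S)
    (hm : MeasurableSet S) {f g : ℝ × ℝ → ℝ} (hf : Continuous f) (hg : Continuous g) {B : ℝ}
    (hB : 0 ≤ B) (h : ∀ x ∈ S, |f x| ≤ B * |g x|) (s : ENNReal) :
    lpNorm f s (volume.restrict S) ≤ B * lpNorm g s (volume.restrict S) := by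
  rw [← toReal_eLpNorm hf.aestronglyMeasurable, ← toReal_eLpNorm hg.aestronglyMeasurable]
  have := eLpNorm_le_mul_eLpNorm_of_ae_le_mul (μ := volume.restrict S) (f := f) (g := g) (c := B)
    (by filter_upwards [ae_restrict_mem hm] with x hx using h x hx) s
  have h2 := ENNReal.toReal_mono (ENNReal.mul_ne_top ENNReal.ofReal_ne_top
    (memLp_of_continuous_bounded hS hm hg s).eLpNorm_ne_top) this
  rwa [ENNReal.toReal_mul, ENNReal.toReal_ofReal hB] at h2

lemma exists_lpNorm_le_lpNorm {S : Set (ℝ × ℝ)} (hS : Bornology.IsBounded S)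
    (hm : MeasurableSet S) {s t : ENNReal} (hst : s ≤ t) : ∃ c : ℝ, 0 ≤ c ∧
    ∀ f : ℝ × ℝ → ℝ, Continuous f →
      lpNorm f s (volume.restrict S) ≤ c * lpNorm f t (volume.restrict S) := by
  have : IsFiniteMeasure (volume.restrict S) := ⟨by simpa using hS.measure_lt_top⟩
  rcases eq_or_ne s 0 with rfl | hs0
  · exact ⟨0, le_rfl, fun f _ => by simp⟩
  refine ⟨((volume.restrict S) Set.univ ^ (1 / s.toReal - 1 / t.toReal)).toReal,
    ENNReal.toReal_nonneg, fun f hf => ?_⟩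
  have hexp : 0 ≤ 1 / s.toReal - 1 / t.toReal := by
    rcases eq_or_ne t ⊤ with rfl | ht
    · simp
    · rw [sub_nonneg]
      have hs : s ≠ ⊤ := ne_top_of_le_ne_top ht hst
      exact one_div_le_one_div_of_le (ENNReal.toReal_pos hs0 hs) (ENNReal.toReal_mono ht hst)
  rw [← toReal_eLpNorm hf.aestronglyMeasurable, ← toReal_eLpNorm hf.aestronglyMeasurable,
    ← ENNReal.toReal_mul, mul_comm]
  refine ENNReal.toReal_mono (ENNReal.mul_ne_top
    (memLp_of_continuous_bounded hS hm hf t).eLpNorm_ne_top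
    (ENNReal.rpow_ne_top_of_nonneg hexp (measure_ne_top _ _))) ?_
  exact eLpNorm_le_eLpNorm_mul_rpow_measure_univ hst hf.aestronglyMeasurable

lemma lpNorm_mul_le_of_holder {S : Set (ℝ × ℝ)} (hS : Bornology.IsBounded S)
    (hm : MeasurableSet S) {f g : ℝ × ℝ → ℝ} (hf : Continuous f) (hg : Continuous g)
    (p q r : ENNReal) [ENNReal.HolderTriple p q r] :
    lpNorm (fun x => f x * g x) r (volume.restrict S) ≤
      lpNorm f p (volume.restrict S) * lpNorm g q (volume.restrict S) := by
  have hfg : Continuous fun x => f x * g x := hf.mul hg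
  rw [← toReal_eLpNorm hf.aestronglyMeasurable, ← toReal_eLpNorm hg.aestronglyMeasurable,
    ← toReal_eLpNorm hfg.aestronglyMeasurable, ← ENNReal.toReal_mul]
  have key := eLpNorm_smul_le_mul_eLpNorm (𝕜 := ℝ) (E := ℝ) (μ := volume.restrict S) (f := g)
    (p := p) (q := q) (r := r) hg.aestronglyMeasurable (φ := f) hf.aestronglyMeasurable
  have e : (fun x => f x * g x) = f • g := by ext x; simp
  rw [e]
  exact ENNReal.toReal_mono (ENNReal.mul_ne_top
    (memLp_of_continuous_bounded hS hm hf p).eLpNorm_ne_top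
    (memLp_of_continuous_bounded hS hm hg q).eLpNorm_ne_top) key

lemma lpNorm_abs_rpow {S : Set (ℝ × ℝ)} {f : ℝ × ℝ → ℝ} (hf : Continuous f) {s : ℝ} (hs : 0 < s)
    (p : ENNReal) :
    lpNorm (fun x => |f x| ^ s) p (volume.restrict S) =
      lpNorm f (p * ENNReal.ofReal s) (volume.restrict S) ^ s := by
  have hc : Continuous fun x => |f x| ^ s := hf.abs.rpow_const fun _ => Or.inr hs.le
  rw [← toReal_eLpNorm hf.aestronglyMeasurable, ← toReal_eLpNorm hc.aestronglyMeasurable,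
    ENNReal.toReal_rpow, ← eLpNorm_norm_rpow f hs]
  rfl

lemma integral_mul_rpow_mul_le {S : Set (ℝ × ℝ)} (hS : Bornology.IsBounded S)
    (hm : MeasurableSet S) {f g h : ℝ × ℝ → ℝ} (hf : Continuous f) (hg : Continuous g)
    (hh : Continuous h) {s : ℝ} (hs : 0 < s) (q r : ENNReal)
    [ENNReal.HolderTriple q r (ENNReal.ofReal ((s + 2) / 2))] :
    ∫ x in S, |f x| * |g x| ^ s * |h x| ≤
      lpNorm f q (volume.restrict S) * lpNorm g (ENNReal.ofReal (s + 2)) (volume.restrict S) ^ s *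
        lpNorm h r (volume.restrict S) := by
  have hc : Continuous fun x => |g x| ^ s := hg.abs.rpow_const fun _ => Or.inr hs.le
  have hfh : Continuous fun x => f x * h x := hf.mul hh
  have hT : ENNReal.HolderTriple (ENNReal.ofReal ((s + 2) / 2))
      (ENNReal.ofReal ((s + 2) / s)) 1 := by
    constructor
    rw [← ENNReal.ofReal_inv_of_pos (by positivity), ← ENNReal.ofReal_inv_of_pos (by positivity),
      ← ENNReal.ofReal_add (by positivity) (by positivity), inv_one, ← ENNReal.ofReal_one]
    congr 1
    field_simp
    ring
  have e1 : ∫ x in S, |f x| * |g x| ^ s * |h x| =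
      lpNorm (fun x => (f x * h x) * |g x| ^ s) 1 (volume.restrict S) := by
    have hfhg : Continuous fun x => f x * h x * |g x| ^ s := hfh.mul hc
    rw [lpNorm_one_eq_integral_norm hfhg.aestronglyMeasurable]
    refine integral_congr_ae (Filter.Eventually.of_forall fun x => ?_)
    have : 0 ≤ |g x| ^ s := by positivity
    simp only [norm_mul, Real.norm_eq_abs, abs_of_nonneg this]
    ring
  rw [e1]
  refine (lpNorm_mul_le_of_holder hS hm hfh hc (ENNReal.ofReal ((s + 2) / 2))
    (ENNReal.ofReal ((s + 2) / s)) 1).trans ?_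
  rw [lpNorm_abs_rpow hg hs, ← ENNReal.ofReal_mul (by positivity), div_mul_cancel₀ _ hs.ne']
  have := lpNorm_mul_le_of_holder hS hm hf hh q r (ENNReal.ofReal ((s + 2) / 2))
  calc _ ≤ _ := mul_le_mul_of_nonneg_right this (Real.rpow_nonneg lpNorm_nonneg _)
    _ = _ := by ring

lemma lpNorm_rpow_eq_integral {S : Set (ℝ × ℝ)} {f : ℝ × ℝ → ℝ} (hf : Continuous f) {p : ℝ}
    (hp : 0 < p) :
    lpNorm f (ENNReal.ofReal p) (volume.restrict S) ^ p = ∫ x in S, |f x| ^ p := by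
  rw [lpNorm_eq_integral_norm_rpow_toReal (by simpa using hp) (by simp) hf.aestronglyMeasurable,
    ENNReal.toReal_ofReal hp.le, Real.rpow_inv_rpow _ hp.ne']
  · rfl
  · positivity

/-- Dilation by `3/4` in the first variable. -/
lemma lpNorm_dilation_le {l c d : ℝ} {f : ℝ × ℝ → ℝ} (hf : Continuous f)
    {s : ENNReal} (hs : 1 ≤ s) :
    lpNorm (fun x : ℝ × ℝ => f (3 / 4 * x.1, x.2)) s
      (volume.restrict (Set.Ioo 0 l ×ˢ Set.Ioo c d)) ≤
    2 * lpNorm f s (volume.restrict (Set.Ioo 0 l ×ˢ Set.Ioo c d)) := by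
  set S : Set (ℝ × ℝ) := Set.Ioo 0 l ×ˢ Set.Ioo c d
  have hS : Bornology.IsBounded S := (Metric.isBounded_Ioo _ _).prod (Metric.isBounded_Ioo _ _)
  have hm : MeasurableSet S := measurableSet_Ioo.prod measurableSet_Ioo
  set δ : ℝ × ℝ → ℝ × ℝ := Prod.map (fun t => 3 / 4 * t) id
  have hδ : Measurable δ := by fun_prop
  have hδc : Continuous δ := by fun_prop
  have hmap : Measure.map δ (volume : Measure (ℝ × ℝ)) = ENNReal.ofReal (4 / 3) • volume := by
    rw [Measure.volume_eq_prod, ← Measure.map_prod_map _ _ (by fun_prop) measurable_id,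
      Real.map_volume_mul_left (by norm_num), Measure.map_id, Measure.prod_smul_left]
    norm_num
  have hsub : S ⊆ δ ⁻¹' S := by
    rintro ⟨x, y⟩ ⟨⟨h1, h2⟩, h3⟩
    exact ⟨⟨by simp only [δ, Prod.map]; linarith, by simp only [δ, Prod.map]; linarith⟩, h3⟩
  have h1 : eLpNorm (f ∘ δ) s (volume.restrict S) ≤
      ENNReal.ofReal (4 / 3) ^ (1 / s).toReal • eLpNorm f s (volume.restrict S) := by
    calc eLpNorm (f ∘ δ) s (volume.restrict S)
        ≤ eLpNorm (f ∘ δ) s (volume.restrict (δ ⁻¹' S)) :=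
          eLpNorm_mono_measure _ (Measure.restrict_mono hsub le_rfl)
      _ = eLpNorm f s (Measure.map δ (volume.restrict (δ ⁻¹' S))) :=
          (eLpNorm_map_measure hf.aestronglyMeasurable hδ.aemeasurable).symm
      _ = eLpNorm f s (ENNReal.ofReal (4 / 3) • volume.restrict S) := by
          rw [← Measure.restrict_map hδ hm, hmap, Measure.restrict_smul]
      _ ≤ _ := eLpNorm_smul_measure_le _ _ _ _
  have h2 : ENNReal.ofReal (4 / 3) ^ (1 / s).toReal ≤ 2 := by
    have : (1 / s).toReal ≤ 1 := by
      have : 1 / s ≤ 1 := by simpa using hs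
      simpa using ENNReal.toReal_mono ENNReal.one_ne_top this
    calc ENNReal.ofReal (4 / 3) ^ (1 / s).toReal ≤ ENNReal.ofReal (4 / 3) ^ (1 : ℝ) :=
          ENNReal.rpow_le_rpow_of_exponent_le (by simp; norm_num) this
      _ ≤ 2 := by
          rw [ENNReal.rpow_one, ← ENNReal.ofReal_ofNat]
          exact ENNReal.ofReal_le_ofReal (by norm_num)
  have h3 : eLpNorm (f ∘ δ) s (volume.restrict S) ≤ 2 * eLpNorm f s (volume.restrict S) :=
    h1.trans (by rw [smul_eq_mul]; gcongr)
  change lpNorm (f ∘ δ) s _ ≤ _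
  rw [← toReal_eLpNorm hf.aestronglyMeasurable,
    ← toReal_eLpNorm (hf.comp hδc).aestronglyMeasurable]
  have := ENNReal.toReal_mono (ENNReal.mul_ne_top (by simp)
    (memLp_of_continuous_bounded hS hm hf s).eLpNorm_ne_top) h3
  simpa using this

lemma lpNorm_combination_le {l c d : ℝ} {f : ℝ × ℝ → ℝ} (hf : Continuous f) {a b : ℝ}
    (ha : |a| ≤ 8) (hb : |b| ≤ 7) {s : ENNReal} (hs : 1 ≤ s) :
    lpNorm (fun x : ℝ × ℝ => a * f (3 / 4 * x.1, x.2) + b * f x) s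
      (volume.restrict (Set.Ioo 0 l ×ˢ Set.Ioo c d)) ≤
    23 * lpNorm f s (volume.restrict (Set.Ioo 0 l ×ˢ Set.Ioo c d)) := by
  set S : Set (ℝ × ℝ) := Set.Ioo 0 l ×ˢ Set.Ioo c d with hSdef
  have hS : Bornology.IsBounded S := (Metric.isBounded_Ioo _ _).prod (Metric.isBounded_Ioo _ _)
  have hm : MeasurableSet S := measurableSet_Ioo.prod measurableSet_Ioo
  have hfd : Continuous fun x : ℝ × ℝ => f (3 / 4 * x.1, x.2) := by fun_prop
  have h1 : Continuous fun x : ℝ × ℝ => a * f (3 / 4 * x.1, x.2) := by fun_prop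
  have h2 : Continuous fun x : ℝ × ℝ => b * f x := by fun_prop
  have e1 := lpNorm_le_mul_of_abs_le hS hm h1 hfd (B := 8) (by norm_num)
    (fun x _ => by rw [abs_mul]; gcongr) s
  have e2 := lpNorm_le_mul_of_abs_le hS hm h2 hf (B := 7) (by norm_num)
    (fun x _ => by rw [abs_mul]; gcongr) s
  have e3 := lpNorm_dilation_le (l := l) (c := c) (d := d) hf hs
  have e4 := lpNorm_add_le (memLp_of_continuous_bounded hS hm h1 s)
    (g := fun x : ℝ × ℝ => b * f x) hs
  calc _ ≤ _ := e4
    _ ≤ 23 * lpNorm f s (volume.restrict S) := by linarith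

/-- Interpolation of the first `x₁`-derivative, for functions vanishing where the boundary terms
of the integration by parts do not cancel. -/
lemma lpNorm_deriv_sq_le_of_vanish {l c d s : ℝ} (hs : 0 < s) (hl : 0 < l)
    {G G₁ G₂ : ℝ × ℝ → ℝ} (cG : Continuous G) (cG₁ : Continuous G₁) (cG₂ : Continuous G₂)
    (hG : ∀ t y, HasDerivAt (fun t => G (t, y)) (G₁ (t, y)) t)
    (hG₁ : ∀ t y, HasDerivAt (fun t => G₁ (t, y)) (G₂ (t, y)) t)
    (hGl : ∀ y, G (l, y) = 0) (hGl' : ∀ y, G (3 / 4 * l, y) = 0)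
    (q r : ENNReal) (hq : 1 ≤ q) (hr : 1 ≤ r)
    [ENNReal.HolderTriple q r (ENNReal.ofReal ((s + 2) / 2))] :
    lpNorm G₁ (ENNReal.ofReal (s + 2)) (volume.restrict (Set.Ioo 0 l ×ˢ Set.Ioo c d)) ^ 2 ≤
      (s + 1) * (1 + 23 * 23 ^ s * 23) *
      (lpNorm G q (volume.restrict (Set.Ioo 0 l ×ˢ Set.Ioo c d)) *
        lpNorm G₂ r (volume.restrict (Set.Ioo 0 l ×ˢ Set.Ioo c d))) := by
  set S : Set (ℝ × ℝ) := Set.Ioo 0 l ×ˢ Set.Ioo c d with hSdef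
  have hS : Bornology.IsBounded S := (Metric.isBounded_Ioo _ _).prod (Metric.isBounded_Ioo _ _)
  have hm : MeasurableSet S := measurableSet_Ioo.prod measurableSet_Ioo
  set K : ℝ × ℝ → ℝ := fun x => 8 * G (3 / 4 * x.1, x.2) + (-7) * G x with hK
  set K₁ : ℝ × ℝ → ℝ := fun x => 6 * G₁ (3 / 4 * x.1, x.2) + (-7) * G₁ x with hK₁
  set K₂ : ℝ × ℝ → ℝ := fun x => (9 / 2) * G₂ (3 / 4 * x.1, x.2) + (-7) * G₂ x with hK₂
  have cK : Continuous K := by fun_prop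
  have cK₁ : Continuous K₁ := by fun_prop
  have cK₂ : Continuous K₂ := by fun_prop
  have dil : ∀ {F F' : ℝ × ℝ → ℝ}, (∀ t y, HasDerivAt (fun t => F (t, y)) (F' (t, y)) t) →
      ∀ t y, HasDerivAt (fun t => F (3 / 4 * t, y)) (F' (3 / 4 * t, y) * (3 / 4)) t := by
    intro F F' h t y
    have h1 : HasDerivAt (fun t : ℝ => 3 / 4 * t) (3 / 4) t := by
      simpa using (hasDerivAt_id t).const_mul (3 / 4 : ℝ)
    exact (h (3 / 4 * t) y).comp t h1
  have dK : ∀ t y, HasDerivAt (fun t => K (t, y)) (K₁ (t, y)) t := fun t y =>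
    (((dil hG t y).const_mul 8).add ((hG t y).const_mul (-7))).congr_deriv (by simp [hK₁]; ring)
  have dK₁ : ∀ t y, HasDerivAt (fun t => K₁ (t, y)) (K₂ (t, y)) t := fun t y =>
    (((dil hG₁ t y).const_mul 6).add ((hG₁ t y).const_mul (-7))).congr_deriv
      (by simp [hK₂]; ring)
  set p : ENNReal := ENNReal.ofReal (s + 2) with hp
  have hp1 : 1 ≤ p := by
    rw [hp, ← ENNReal.ofReal_one]; exact ENNReal.ofReal_le_ofReal (by linarith)
  have cG₁s : Continuous fun x => |G₁ x| ^ s := cG₁.abs.rpow_const fun _ => Or.inr hs.le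
  have cK₁s : Continuous fun x => |K₁ x| ^ s := cK₁.abs.rpow_const fun _ => Or.inr hs.le
  have cG₁s2 : Continuous fun x => |G₁ x| ^ (s + 2) :=
    cG₁.abs.rpow_const fun _ => Or.inr (by linarith)
  have c1 : Continuous fun x => |G x| * |G₁ x| ^ s * |G₂ x| := by fun_prop
  have c2 : Continuous fun x => |K x| * |K₁ x| ^ s * |K₂ x| := by fun_prop
  have c3 : Continuous fun x => |G x| * |G₁ x| ^ s * |G₂ x| + |K x| * |K₁ x| ^ s * |K₂ x| :=
    c1.add c2
  have int : ∀ {F : ℝ × ℝ → ℝ}, Continuous F → Integrable F (volume.restrict S) := fun hF =>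
    memLp_one_iff_integrable.1 (memLp_of_continuous_bounded hS hm hF 1)
  have hprod : (volume.restrict S : Measure (ℝ × ℝ)) =
      (volume.restrict (Set.Ioo 0 l)).prod (volume.restrict (Set.Ioo c d)) := by
    rw [Measure.prod_restrict, Measure.volume_eq_prod]
  have fub : ∫ x in S, |G₁ x| ^ (s + 2) ≤
      (s + 1) * ∫ x in S, (|G x| * |G₁ x| ^ s * |G₂ x| + |K x| * |K₁ x| ^ s * |K₂ x|) := by
    have i1 := int cG₁s2
    have i2 := int c3
    rw [hprod] at i1 i2 ⊢
    rw [integral_prod_symm _ i1, integral_prod_symm _ i2, ← integral_const_mul]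
    refine integral_mono i1.integral_prod_right (i2.integral_prod_right.const_mul _) fun y => ?_
    exact integral_abs_deriv_rpow_le hs hl (fun t => hG t y) (fun t => hG₁ t y) (by fun_prop)
      (fun t => dK t y) (fun t => dK₁ t y) (by fun_prop) (hGl y) (by simp [hK, hGl, hGl'])
      (by simp [hK]; ring) (by simp [hK₁]; ring)
  rw [← lpNorm_rpow_eq_integral cG₁ (by linarith), integral_add (int c1) (int c2)] at fub
  have b1 := integral_mul_rpow_mul_le hS hm cG cG₁ cG₂ hs q r
  have b2 := integral_mul_rpow_mul_le hS hm cK cK₁ cK₂ hs q r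
  have k0 : lpNorm K q (volume.restrict S) ≤ 23 * lpNorm G q (volume.restrict S) :=
    lpNorm_combination_le cG (by norm_num) (by norm_num) hq
  have k1 : lpNorm K₁ p (volume.restrict S) ≤ 23 * lpNorm G₁ p (volume.restrict S) :=
    lpNorm_combination_le cG₁ (by norm_num) (by norm_num) hp1
  have k2 : lpNorm K₂ r (volume.restrict S) ≤ 23 * lpNorm G₂ r (volume.restrict S) :=
    lpNorm_combination_le cG₂ (by norm_num [abs_of_pos]) (by norm_num) hr
  rw [← hp] at b1 b2 fub
  set X := lpNorm G₁ p (volume.restrict S)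
  set Y := lpNorm G q (volume.restrict S)
  set Z := lpNorm G₂ r (volume.restrict S)
  have hX : 0 ≤ X := lpNorm_nonneg
  have hY : 0 ≤ Y := lpNorm_nonneg
  have hZ : 0 ≤ Z := lpNorm_nonneg
  have b3 : lpNorm K q (volume.restrict S) * lpNorm K₁ p (volume.restrict S) ^ s *
      lpNorm K₂ r (volume.restrict S) ≤ (23 * Y) * (23 * X) ^ s * (23 * Z) := by
    have : 0 ≤ lpNorm K₁ p (volume.restrict S) := lpNorm_nonneg
    have : 0 ≤ lpNorm K₂ r (volume.restrict S) := lpNorm_nonneg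
    gcongr
  rw [Real.mul_rpow (by norm_num) hX] at b3
  rcases hX.eq_or_lt with h0 | hpos
  · rw [← h0]; simp; positivity
  · have hXs : 0 < X ^ s := by positivity
    rw [Real.rpow_add hpos, Real.rpow_two] at fub
    refine le_of_mul_le_mul_left ?_ hXs
    calc X ^ s * X ^ 2 ≤ _ := fub
      _ ≤ (s + 1) * (Y * X ^ s * Z + 23 * Y * (23 ^ s * X ^ s) * (23 * Z)) := by
        have := b2.trans b3
        gcongr
      _ = _ := by ring

/-- Interpolation for the `x₁`-derivative weighted away from the right end. -/
lemma exists_lpNorm_weighted_deriv_sq_le {l c d s : ℝ} (hs : 0 < s) (hl : 0 < l)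
    (q r : ENNReal) (hr : 1 ≤ r) (hrp : r ≤ ENNReal.ofReal (s + 2))
    (hpq : ENNReal.ofReal (s + 2) ≤ q)
    [ENNReal.HolderTriple q r (ENNReal.ofReal ((s + 2) / 2))] :
    ∃ C : ℝ, 0 ≤ C ∧ ∀ h h₁ h₂ : ℝ × ℝ → ℝ, Continuous h → Continuous h₁ → Continuous h₂ →
    (∀ t y, HasDerivAt (fun t => h (t, y)) (h₁ (t, y)) t) →
    (∀ t y, HasDerivAt (fun t => h₁ (t, y)) (h₂ (t, y)) t) →
    lpNorm (fun x => (l - x.1) * (3 * l - 4 * x.1) * h₁ x) (ENNReal.ofReal (s + 2))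
        (volume.restrict (Set.Ioo 0 l ×ˢ Set.Ioo c d)) ^ 2 ≤
      C * (lpNorm h q (volume.restrict (Set.Ioo 0 l ×ˢ Set.Ioo c d)) *
        (lpNorm h q (volume.restrict (Set.Ioo 0 l ×ˢ Set.Ioo c d)) +
        lpNorm h₁ (ENNReal.ofReal (s + 2)) (volume.restrict (Set.Ioo 0 l ×ˢ Set.Ioo c d)) +
        lpNorm h₂ r (volume.restrict (Set.Ioo 0 l ×ˢ Set.Ioo c d)))) := by
  set S : Set (ℝ × ℝ) := Set.Ioo 0 l ×ˢ Set.Ioo c d with hSdef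
  have hS : Bornology.IsBounded S := (Metric.isBounded_Ioo _ _).prod (Metric.isBounded_Ioo _ _)
  have hm : MeasurableSet S := measurableSet_Ioo.prod measurableSet_Ioo
  set p : ENNReal := ENNReal.ofReal (s + 2) with hp
  have hp1 : 1 ≤ p := by
    rw [hp, ← ENNReal.ofReal_one]; exact ENNReal.ofReal_le_ofReal (by linarith)
  obtain ⟨k1, hk1, Hk1⟩ := exists_lpNorm_le_lpNorm hS hm hpq
  obtain ⟨k2, hk2, Hk2⟩ := exists_lpNorm_le_lpNorm hS hm (hrp.trans hpq)
  obtain ⟨k3, hk3, Hk3⟩ := exists_lpNorm_le_lpNorm hS hm hrp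
  set B : ℝ := 8 + 14 * l + 7 * l ^ 2 with hB
  have hB0 : 0 ≤ B := by positivity
  set M : ℝ := (s + 1) * (1 + 23 * 23 ^ s * 23) with hM
  have hM0 : 0 ≤ M := by positivity
  refine ⟨2 * (M * (B * (B * (k2 + 2 * k3 + 1)))) + 2 * (B * k1) ^ 2, by positivity, ?_⟩
  intro h h₁ h₂ ch ch₁ ch₂ dh dh₁
  set χ : ℝ → ℝ := fun t => (l - t) * (3 * l - 4 * t) with hχ
  set χ₁ : ℝ → ℝ := fun t => 8 * t - 7 * l with hχ₁
  have dχ : ∀ t, HasDerivAt χ (χ₁ t) t := fun t =>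
    (((hasDerivAt_id t).const_sub l).mul (((hasDerivAt_id t).const_mul 4).const_sub (3 * l))
      ).congr_deriv (by simp [hχ₁]; ring)
  have dχ₁ : ∀ t, HasDerivAt χ₁ 8 t := fun t =>
    (((hasDerivAt_id t).const_mul 8).sub_const (7 * l)).congr_deriv (by simp)
  have cχ : Continuous χ := by fun_prop
  have cχ₁ : Continuous χ₁ := by fun_prop
  have bχ : ∀ x ∈ S, |χ x.1| ≤ B := by
    rintro ⟨t, y⟩ ⟨⟨h1, h2⟩, -⟩
    simp only at h1 h2 ⊢
    rw [abs_le]; constructor <;> simp only [hχ, hB] <;> nlinarith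
  have bχ₁ : ∀ x ∈ S, |χ₁ x.1| ≤ B := by
    rintro ⟨t, y⟩ ⟨⟨h1, h2⟩, -⟩
    simp only at h1 h2 ⊢
    rw [abs_le]; constructor <;> simp only [hχ₁, hB] <;> nlinarith
  set G : ℝ × ℝ → ℝ := fun x => χ x.1 * h x with hG
  set G₁ : ℝ × ℝ → ℝ := fun x => χ₁ x.1 * h x + χ x.1 * h₁ x with hG₁
  set G₂ : ℝ × ℝ → ℝ := fun x => 8 * h x + (2 * (χ₁ x.1 * h₁ x) + χ x.1 * h₂ x) with hG₂
  have cG : Continuous G := by fun_prop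
  have cG₁ : Continuous G₁ := by fun_prop
  have cG₂ : Continuous G₂ := by fun_prop
  have dG : ∀ t y, HasDerivAt (fun t => G (t, y)) (G₁ (t, y)) t := fun t y =>
    (dχ t).mul (dh t y)
  have dG₁ : ∀ t y, HasDerivAt (fun t => G₁ (t, y)) (G₂ (t, y)) t := fun t y =>
    (((dχ₁ t).mul (dh t y)).add ((dχ t).mul (dh₁ t y))).congr_deriv (by simp [hG₂]; ring)
  have main := lpNorm_deriv_sq_le_of_vanish (c := c) (d := d) hs hl cG cG₁ cG₂ dG dG₁
    (fun y => by simp [hG, hχ]) (fun y => by simp [hG, hχ]; left; right; ring)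
    q r (hp1.trans hpq) hr
  rw [← hp, ← hM, ← hSdef] at main
  have cA : Continuous fun x : ℝ × ℝ => χ₁ x.1 * h x := by fun_prop
  have cD : Continuous fun x : ℝ × ℝ => χ₁ x.1 * h₁ x := by fun_prop
  have cD' : Continuous fun x : ℝ × ℝ => 2 * (χ₁ x.1 * h₁ x) := by fun_prop
  have cE : Continuous fun x : ℝ × ℝ => χ x.1 * h₂ x := by fun_prop
  have cF : Continuous fun x : ℝ × ℝ => 8 * h x := by fun_prop
  have nG : lpNorm G q (volume.restrict S) ≤ B * lpNorm h q (volume.restrict S) :=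
    lpNorm_le_mul_of_abs_le hS hm cG ch hB0
      (fun x hx => by rw [hG, abs_mul]; gcongr; exact bχ x hx) q
  have nA : lpNorm (fun x => χ₁ x.1 * h x) p (volume.restrict S) ≤
      B * lpNorm h p (volume.restrict S) :=
    lpNorm_le_mul_of_abs_le hS hm cA ch hB0
      (fun x hx => by rw [abs_mul]; gcongr; exact bχ₁ x hx) p
  have nD : lpNorm (fun x => 2 * (χ₁ x.1 * h₁ x)) r (volume.restrict S) ≤
      (2 * B) * lpNorm h₁ r (volume.restrict S) :=
    lpNorm_le_mul_of_abs_le hS hm cD' ch₁ (by positivity)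
      (fun x hx => by rw [abs_mul, abs_mul, abs_two, mul_assoc]; gcongr; exact bχ₁ x hx) r
  have nE : lpNorm (fun x => χ x.1 * h₂ x) r (volume.restrict S) ≤
      B * lpNorm h₂ r (volume.restrict S) :=
    lpNorm_le_mul_of_abs_le hS hm cE ch₂ hB0
      (fun x hx => by rw [abs_mul]; gcongr; exact bχ x hx) r
  have nF : lpNorm (fun x => 8 * h x) r (volume.restrict S) ≤
      B * lpNorm h r (volume.restrict S) :=
    lpNorm_le_mul_of_abs_le hS hm cF ch hB0
      (fun x hx => by
        rw [abs_mul]; gcongr; rw [abs_of_pos (by norm_num)]; simp only [hB]; nlinarith) r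
  have nG₂ : lpNorm G₂ r (volume.restrict S) ≤ B * lpNorm h r (volume.restrict S) +
      (2 * B * lpNorm h₁ r (volume.restrict S) + B * lpNorm h₂ r (volume.restrict S)) := by
    have t1 := lpNorm_add_le (memLp_of_continuous_bounded hS hm cF r)
      (g := fun x : ℝ × ℝ => 2 * (χ₁ x.1 * h₁ x) + χ x.1 * h₂ x) hr
    have t2 := lpNorm_add_le (memLp_of_continuous_bounded hS hm cD' r)
      (g := fun x : ℝ × ℝ => χ x.1 * h₂ x) hr
    calc _ ≤ _ := t1
      _ ≤ _ := add_le_add nF (t2.trans (add_le_add nD nE))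
  have nW : lpNorm (fun x => χ x.1 * h₁ x) p (volume.restrict S) ≤
      lpNorm G₁ p (volume.restrict S) + lpNorm (fun x => χ₁ x.1 * h x) p (volume.restrict S) := by
    have := lpNorm_sub_le (memLp_of_continuous_bounded hS hm cG₁ p)
      (g := fun x : ℝ × ℝ => χ₁ x.1 * h x) hp1
    refine le_trans (le_of_eq ?_) this
    congr 1; ext x; simp [hG₁]
  change lpNorm (fun x => χ x.1 * h₁ x) p (volume.restrict S) ^ 2 ≤ _
  have i1 := Hk1 h ch
  have i2 := Hk2 h ch
  have i3 := Hk3 h₁ ch₁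
  have pos0 : 0 ≤ lpNorm (fun x => χ x.1 * h₁ x) p (volume.restrict S) := lpNorm_nonneg
  have pos1 : 0 ≤ lpNorm G₁ p (volume.restrict S) := lpNorm_nonneg
  have pos2 : 0 ≤ lpNorm (fun x => χ₁ x.1 * h x) p (volume.restrict S) := lpNorm_nonneg
  have pos3 : 0 ≤ lpNorm G q (volume.restrict S) := lpNorm_nonneg
  have pos4 : 0 ≤ lpNorm G₂ r (volume.restrict S) := lpNorm_nonneg
  set a := lpNorm h q (volume.restrict S)
  set b := lpNorm h₁ p (volume.restrict S)
  set e := lpNorm h₂ r (volume.restrict S)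
  have ha : 0 ≤ a := lpNorm_nonneg
  have hb : 0 ≤ b := lpNorm_nonneg
  have he : 0 ≤ e := lpNorm_nonneg
  have j2 : lpNorm G₂ r (volume.restrict S) ≤ B * (k2 + 2 * k3 + 1) * (a + b + e) := by
    have z1 : B * lpNorm h r (volume.restrict S) ≤ B * (k2 * a) := by gcongr
    have z2 : 2 * B * lpNorm h₁ r (volume.restrict S) ≤ 2 * B * (k3 * b) := by gcongr
    refine nG₂.trans (le_trans (add_le_add z1 (add_le_add_left z2 _)) ?_)
    have : 0 ≤ B * (k2 * (b + e) + 2 * k3 * (a + e) + (a + b)) := by positivity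
    linarith
  have j1 : lpNorm (fun x => χ₁ x.1 * h x) p (volume.restrict S) ≤ B * k1 * a :=
    nA.trans (by rw [mul_assoc]; gcongr)
  calc lpNorm (fun x => χ x.1 * h₁ x) p (volume.restrict S) ^ 2
      ≤ (lpNorm G₁ p (volume.restrict S) +
          lpNorm (fun x => χ₁ x.1 * h x) p (volume.restrict S)) ^ 2 := by gcongr
    _ ≤ 2 * lpNorm G₁ p (volume.restrict S) ^ 2 +
          2 * lpNorm (fun x => χ₁ x.1 * h x) p (volume.restrict S) ^ 2 := by
        nlinarith [sq_nonneg (lpNorm G₁ p (volume.restrict S) -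
          lpNorm (fun x => χ₁ x.1 * h x) p (volume.restrict S))]
    _ ≤ 2 * (M * ((B * a) * (B * (k2 + 2 * k3 + 1) * (a + b + e)))) + 2 * (B * k1 * a) ^ 2 := by
        have : lpNorm G₁ p (volume.restrict S) ^ 2 ≤
            M * ((B * a) * (B * (k2 + 2 * k3 + 1) * (a + b + e))) :=
          main.trans (by gcongr)
        gcongr
    _ ≤ _ := by
        have : 0 ≤ 2 * (B * k1) ^ 2 * (a * (b + e)) := by positivity
        linarith

lemma lpNorm_comp_measurePreserving {S S' : Set (ℝ × ℝ)} (hm : MeasurableSet S)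
    {T : ℝ × ℝ → ℝ × ℝ} (hT : MeasurePreserving T volume volume) (hTc : Continuous T)
    (hS : T ⁻¹' S = S') {f : ℝ × ℝ → ℝ} (hf : Continuous f) (s : ENNReal) :
    lpNorm (fun x => f (T x)) s (volume.restrict S') = lpNorm f s (volume.restrict S) := by
  have := eLpNorm_comp_measurePreserving (p := s) hf.aestronglyMeasurable
    (hT.restrict_preimage hm)
  rw [hS] at this
  change lpNorm (f ∘ T) s _ = _
  rw [← toReal_eLpNorm hf.aestronglyMeasurable,
    ← toReal_eLpNorm (hf.comp hTc).aestronglyMeasurable, this]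

/-- Gagliardo–Nirenberg interpolation of an `x₁`-derivative on a rectangle. -/
lemma exists_lpNorm_fst_deriv_sq_le {a b c d s : ℝ} (hs : 0 < s) (hab : a < b)
    (q r : ENNReal) (hr : 1 ≤ r) (hrp : r ≤ ENNReal.ofReal (s + 2))
    (hpq : ENNReal.ofReal (s + 2) ≤ q)
    [ENNReal.HolderTriple q r (ENNReal.ofReal ((s + 2) / 2))] :
    ∃ C : ℝ, 0 ≤ C ∧ ∀ h h₁ h₂ : ℝ × ℝ → ℝ, Continuous h → Continuous h₁ → Continuous h₂ →
    (∀ t y, HasDerivAt (fun t => h (t, y)) (h₁ (t, y)) t) →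
    (∀ t y, HasDerivAt (fun t => h₁ (t, y)) (h₂ (t, y)) t) →
    lpNorm h₁ (ENNReal.ofReal (s + 2)) (volume.restrict (Set.Ioo a b ×ˢ Set.Ioo c d)) ^ 2 ≤
      C * (lpNorm h q (volume.restrict (Set.Ioo a b ×ˢ Set.Ioo c d)) *
        (lpNorm h q (volume.restrict (Set.Ioo a b ×ˢ Set.Ioo c d)) +
        lpNorm h₁ (ENNReal.ofReal (s + 2)) (volume.restrict (Set.Ioo a b ×ˢ Set.Ioo c d)) +
        lpNorm h₂ r (volume.restrict (Set.Ioo a b ×ˢ Set.Ioo c d)))) := by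
  set S : Set (ℝ × ℝ) := Set.Ioo a b ×ˢ Set.Ioo c d with hSdef
  have hS : Bornology.IsBounded S := (Metric.isBounded_Ioo _ _).prod (Metric.isBounded_Ioo _ _)
  have hm : MeasurableSet S := measurableSet_Ioo.prod measurableSet_Ioo
  set p : ENNReal := ENNReal.ofReal (s + 2) with hp
  have hp1 : 1 ≤ p := by
    rw [hp, ← ENNReal.ofReal_one]; exact ENNReal.ofReal_le_ofReal (by linarith)
  set l : ℝ := b - a with hl
  have hl0 : 0 < l := sub_pos.2 hab
  obtain ⟨M, hM, H⟩ := exists_lpNorm_weighted_deriv_sq_le (l := l) (c := c) (d := d) hs hl0 q r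
    hr hrp hpq
  rw [← hp] at H
  refine ⟨(2 / l ^ 2) ^ 2 * (4 * M), by positivity, ?_⟩
  intro h h₁ h₂ ch ch₁ ch₂ dh dh₁
  set T₁ : ℝ × ℝ → ℝ × ℝ := fun x => (a + x.1, x.2) with hT₁
  set T₂ : ℝ × ℝ → ℝ × ℝ := fun x => (b - x.1, x.2) with hT₂
  have mT₁ : MeasurePreserving T₁ volume volume :=
    (measurePreserving_add_left volume a).prod (MeasurePreserving.id volume)
  have mT₂ : MeasurePreserving T₂ volume volume :=
    (Measure.measurePreserving_sub_left volume b).prod (MeasurePreserving.id volume)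
  have cT₁ : Continuous T₁ := by fun_prop
  have cT₂ : Continuous T₂ := by fun_prop
  have pT₁ : T₁ ⁻¹' S = Set.Ioo 0 l ×ˢ Set.Ioo c d := by
    ext ⟨x, y⟩
    simp only [hSdef, hT₁, hl, Set.mem_preimage, Set.mem_prod, Set.mem_Ioo]
    refine and_congr_left fun _ => ⟨fun h => ⟨?_, ?_⟩, fun h => ⟨?_, ?_⟩⟩ <;> linarith [h.1, h.2]
  have pT₂ : T₂ ⁻¹' S = Set.Ioo 0 l ×ˢ Set.Ioo c d := by
    ext ⟨x, y⟩
    simp only [hSdef, hT₂, hl, Set.mem_preimage, Set.mem_prod, Set.mem_Ioo]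
    refine and_congr_left fun _ => ⟨fun h => ⟨?_, ?_⟩, fun h => ⟨?_, ?_⟩⟩ <;> linarith [h.1, h.2]
  set w₁ : ℝ × ℝ → ℝ := fun x => (l - (x.1 - a)) * (3 * l - 4 * (x.1 - a)) * h₁ x with hw₁
  set w₂ : ℝ × ℝ → ℝ := fun x => (l - (b - x.1)) * (3 * l - 4 * (b - x.1)) * (-h₁ x) with hw₂
  have cw₁ : Continuous w₁ := by fun_prop
  have cw₂ : Continuous w₂ := by fun_prop
  have ch₁' : Continuous fun x => -h₁ x := ch₁.neg
  have e₁ := fun {f : ℝ × ℝ → ℝ} (hf : Continuous f) =>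
    lpNorm_comp_measurePreserving hm mT₁ cT₁ pT₁ hf
  have e₂ := fun {f : ℝ × ℝ → ℝ} (hf : Continuous f) =>
    lpNorm_comp_measurePreserving hm mT₂ cT₂ pT₂ hf
  have dsub : ∀ t : ℝ, HasDerivAt (fun t => b - t) (-1) t := fun t =>
    (hasDerivAt_id t).const_sub b
  have dadd : ∀ t : ℝ, HasDerivAt (fun t => a + t) 1 t := fun t =>
    (hasDerivAt_id t).const_add a
  have H₁ := H (fun x => h (T₁ x)) (fun x => h₁ (T₁ x)) (fun x => h₂ (T₁ x))
    (ch.comp cT₁) (ch₁.comp cT₁) (ch₂.comp cT₁)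
    (fun t y => ((dh (a + t) y).comp t (dadd t)).congr_deriv (mul_one _))
    (fun t y => ((dh₁ (a + t) y).comp t (dadd t)).congr_deriv (mul_one _))
  have H₂ := H (fun x => h (T₂ x)) (fun x => -h₁ (T₂ x)) (fun x => h₂ (T₂ x))
    (ch.comp cT₂) (ch₁.comp cT₂).neg (ch₂.comp cT₂)
    (fun t y => ((dh (b - t) y).comp t (dsub t)).congr_deriv (by simp [hT₂]))
    (fun t y => ((dh₁ (b - t) y).comp t (dsub t)).neg.congr_deriv (by simp [hT₂]))
  have E₁ := e₁ cw₁ p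
  have E₂ := e₂ cw₂ p
  simp only [hw₁, hw₂, hT₁, hT₂, add_sub_cancel_left, sub_sub_cancel] at E₁ E₂
  rw [E₁, e₁ ch, e₁ ch₁, e₁ ch₂] at H₁
  rw [E₂, e₂ ch, e₂ ch₁', e₂ ch₂, lpNorm_fun_neg] at H₂
  have key : lpNorm h₁ p (volume.restrict S) ≤
      2 / l ^ 2 * (lpNorm w₁ p (volume.restrict S) + lpNorm w₂ p (volume.restrict S)) := by
    have c1 : Continuous fun x => |w₁ x| := cw₁.abs
    have c2 : Continuous fun x => |w₂ x| := cw₂.abs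
    have t1 := lpNorm_add_le (memLp_of_continuous_bounded hS hm c1 p)
      (g := fun x => |w₂ x|) hp1
    rw [lpNorm_fun_abs cw₁.aestronglyMeasurable, lpNorm_fun_abs cw₂.aestronglyMeasurable] at t1
    refine le_trans (lpNorm_le_mul_of_abs_le hS hm ch₁ (c1.add c2)
      (B := 2 / l ^ 2) (by positivity) ?_ p) (by gcongr)
    rintro ⟨x, y⟩ ⟨⟨h1, h2⟩, -⟩
    simp only [Pi.add_apply] at h1 h2 ⊢
    rw [abs_of_nonneg (by positivity : 0 ≤ |w₁ (x, y)| + |w₂ (x, y)|)]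
    have : l ^ 2 / 2 * |h₁ (x, y)| ≤ |w₁ (x, y)| + |w₂ (x, y)| := by
      rcases le_total (x - a) (l / 2) with hx | hx
      · refine le_trans ?_ (le_add_of_nonneg_right (abs_nonneg _))
        rw [hw₁, abs_mul]
        gcongr
        refine le_trans ?_ (le_abs_self _)
        nlinarith
      · refine le_trans ?_ (le_add_of_nonneg_left (abs_nonneg _))
        rw [hw₂, abs_mul, abs_neg]
        gcongr
        refine le_trans ?_ (le_abs_self _)
        nlinarith
    rw [div_mul_eq_mul_div, le_div_iff₀ (by positivity)]
    linarith
  have n0 : 0 ≤ lpNorm h₁ p (volume.restrict S) := lpNorm_nonneg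
  change lpNorm w₁ p (volume.restrict S) ^ 2 ≤ _ at H₁
  change lpNorm w₂ p (volume.restrict S) ^ 2 ≤ _ at H₂
  set Q := lpNorm h q (volume.restrict S) * (lpNorm h q (volume.restrict S) +
    lpNorm h₁ p (volume.restrict S) + lpNorm h₂ r (volume.restrict S))
  calc lpNorm h₁ p (volume.restrict S) ^ 2
      ≤ (2 / l ^ 2 * (lpNorm w₁ p (volume.restrict S) + lpNorm w₂ p (volume.restrict S))) ^ 2 := by
        gcongr
    _ = (2 / l ^ 2) ^ 2 *
        (lpNorm w₁ p (volume.restrict S) + lpNorm w₂ p (volume.restrict S)) ^ 2 := by ring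
    _ ≤ (2 / l ^ 2) ^ 2 * (4 * (M * Q)) := by
        gcongr
        nlinarith [sq_nonneg (lpNorm w₁ p (volume.restrict S) - lpNorm w₂ p (volume.restrict S))]
    _ = _ := by ring

/-- Gagliardo–Nirenberg interpolation of an `x₂`-derivative on a rectangle. -/
lemma exists_lpNorm_snd_deriv_sq_le {a b c d s : ℝ} (hs : 0 < s) (hcd : c < d)
    (q r : ENNReal) (hr : 1 ≤ r) (hrp : r ≤ ENNReal.ofReal (s + 2))
    (hpq : ENNReal.ofReal (s + 2) ≤ q)
    [ENNReal.HolderTriple q r (ENNReal.ofReal ((s + 2) / 2))] :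
    ∃ C : ℝ, 0 ≤ C ∧ ∀ h h₁ h₂ : ℝ × ℝ → ℝ, Continuous h → Continuous h₁ → Continuous h₂ →
    (∀ t y, HasDerivAt (fun t => h (y, t)) (h₁ (y, t)) t) →
    (∀ t y, HasDerivAt (fun t => h₁ (y, t)) (h₂ (y, t)) t) →
    lpNorm h₁ (ENNReal.ofReal (s + 2)) (volume.restrict (Set.Ioo a b ×ˢ Set.Ioo c d)) ^ 2 ≤
      C * (lpNorm h q (volume.restrict (Set.Ioo a b ×ˢ Set.Ioo c d)) *
        (lpNorm h q (volume.restrict (Set.Ioo a b ×ˢ Set.Ioo c d)) +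
        lpNorm h₁ (ENNReal.ofReal (s + 2)) (volume.restrict (Set.Ioo a b ×ˢ Set.Ioo c d)) +
        lpNorm h₂ r (volume.restrict (Set.Ioo a b ×ˢ Set.Ioo c d)))) := by
  obtain ⟨C, hC, H⟩ := exists_lpNorm_fst_deriv_sq_le (c := a) (d := b) hs hcd q r hr hrp hpq
  refine ⟨C, hC, fun h h₁ h₂ ch ch₁ ch₂ dh dh₁ => ?_⟩
  have e := fun {f : ℝ × ℝ → ℝ} (hf : Continuous f) =>
    lpNorm_comp_measurePreserving (S := Set.Ioo a b ×ˢ Set.Ioo c d)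
      (measurableSet_Ioo.prod measurableSet_Ioo)
      (Measure.measurePreserving_swap (μ := volume) (ν := volume)) continuous_swap
      (Set.preimage_swap_prod _ _) hf
  have := H (fun x => h x.swap) (fun x => h₁ x.swap) (fun x => h₂ x.swap)
    (ch.comp continuous_swap) (ch₁.comp continuous_swap) (ch₂.comp continuous_swap) dh dh₁
  rwa [e ch, e ch₁, e ch₂] at this

lemma pder_zero_zero (f : ℝ × ℝ → ℝ) : pder 0 0 f = f := by
  funext p; simp [pder]

lemma pder_one_zero_apply (f : ℝ × ℝ → ℝ) (p : ℝ × ℝ) :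
    pder 1 0 f p = deriv (fun x => f (x, p.2)) p.1 := by
  simp [pder]

lemma pder_zero_one_apply (f : ℝ × ℝ → ℝ) (p : ℝ × ℝ) :
    pder 0 1 f p = deriv (fun y => f (p.1, y)) p.2 := by
  simp [pder]

lemma pder_succ_left (k l : ℕ) (f : ℝ × ℝ → ℝ) : pder (k + 1) l f = pder 1 0 (pder k l f) := by
  funext p
  rw [pder_one_zero_apply, pder, iteratedDeriv_succ]
  rfl

lemma pder_zero_succ (l : ℕ) (f : ℝ × ℝ → ℝ) : pder 0 (l + 1) f = pder 0 1 (pder 0 l f) := by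
  funext p
  rw [pder_zero_one_apply]
  simp [pder, iteratedDeriv_succ]

lemma hasDerivAt_fst_fderiv {f : ℝ × ℝ → ℝ} (hf : Differentiable ℝ f) (t y : ℝ) :
    HasDerivAt (fun t => f (t, y)) (fderiv ℝ f (t, y) (1, 0)) t :=
  (hf (t, y)).hasFDerivAt.comp_hasDerivAt t ((hasDerivAt_id t).prodMk (hasDerivAt_const t y))

lemma hasDerivAt_snd_fderiv {f : ℝ × ℝ → ℝ} (hf : Differentiable ℝ f) (t y : ℝ) :
    HasDerivAt (fun t => f (y, t)) (fderiv ℝ f (y, t) (0, 1)) t :=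
  (hf (y, t)).hasFDerivAt.comp_hasDerivAt t ((hasDerivAt_const t y).prodMk (hasDerivAt_id t))

lemma pder_one_zero_eq_fderiv {f : ℝ × ℝ → ℝ} (hf : Differentiable ℝ f) :
    pder 1 0 f = fun p => fderiv ℝ f p (1, 0) := by
  funext p
  rw [pder_one_zero_apply, (hasDerivAt_fst_fderiv hf p.1 p.2).deriv]

lemma pder_zero_one_eq_fderiv {f : ℝ × ℝ → ℝ} (hf : Differentiable ℝ f) :
    pder 0 1 f = fun p => fderiv ℝ f p (0, 1) := by
  funext p
  rw [pder_zero_one_apply, (hasDerivAt_snd_fderiv hf p.2 p.1).deriv]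

lemma contDiff_pder_one_zero {f : ℝ × ℝ → ℝ} (hf : ContDiff ℝ (⊤ : ℕ∞) f) :
    ContDiff ℝ (⊤ : ℕ∞) (pder 1 0 f) := by
  rw [pder_one_zero_eq_fderiv (hf.differentiable (by simp))]
  exact (hf.fderiv_right (m := (⊤ : ℕ∞)) (by simp)).clm_apply contDiff_const

lemma contDiff_pder_zero_one {f : ℝ × ℝ → ℝ} (hf : ContDiff ℝ (⊤ : ℕ∞) f) :
    ContDiff ℝ (⊤ : ℕ∞) (pder 0 1 f) := by
  rw [pder_zero_one_eq_fderiv (hf.differentiable (by simp))]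
  exact (hf.fderiv_right (m := (⊤ : ℕ∞)) (by simp)).clm_apply contDiff_const

lemma contDiff_pder {f : ℝ × ℝ → ℝ} (hf : ContDiff ℝ (⊤ : ℕ∞) f) (k l : ℕ) :
    ContDiff ℝ (⊤ : ℕ∞) (pder k l f) := by
  induction k with
  | zero =>
    induction l with
    | zero => rwa [pder_zero_zero]
    | succ l ih => rw [pder_zero_succ]; exact contDiff_pder_zero_one ih
  | succ k ih => rw [pder_succ_left]; exact contDiff_pder_one_zero ih

lemma pder_one_zero_comm {f : ℝ × ℝ → ℝ} (hf : ContDiff ℝ (⊤ : ℕ∞) f) :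
    pder 1 0 (pder 0 1 f) = pder 0 1 (pder 1 0 f) := by
  have hd : Differentiable ℝ f := hf.differentiable (by simp)
  have hd' : Differentiable ℝ (fderiv ℝ f) :=
    (hf.fderiv_right (m := (⊤ : ℕ∞)) (by simp)).differentiable (by simp)
  rw [pder_one_zero_eq_fderiv ((contDiff_pder_zero_one hf).differentiable (by simp)),
    pder_zero_one_eq_fderiv ((contDiff_pder_one_zero hf).differentiable (by simp)),
    pder_one_zero_eq_fderiv hd, pder_zero_one_eq_fderiv hd]
  funext p
  rw [fderiv_clm_apply (hd' p) (differentiableAt_const _),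
    fderiv_clm_apply (hd' p) (differentiableAt_const _)]
  have h2 : minSmoothness ℝ 2 ≤ ((⊤ : ℕ∞) : WithTop ℕ∞) := by
    rw [minSmoothness_of_isRCLikeNormedField]
    exact WithTop.coe_le_coe.2 (le_top : (2 : ℕ∞) ≤ ⊤)
  simpa using (hf.contDiffAt (x := p)).isSymmSndFDerivAt h2 (1, 0) (0, 1)

lemma pder_succ_right {f : ℝ × ℝ → ℝ} (hf : ContDiff ℝ (⊤ : ℕ∞) f) (k l : ℕ) :
    pder k (l + 1) f = pder 0 1 (pder k l f) := by
  induction k with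
  | zero => exact pder_zero_succ l f
  | succ k ih =>
    rw [pder_succ_left, ih, pder_one_zero_comm (contDiff_pder hf k l), ← pder_succ_left]

lemma pder_pder_one_zero {f : ℝ × ℝ → ℝ} (hf : ContDiff ℝ (⊤ : ℕ∞) f) (k l : ℕ) :
    pder k l (pder 1 0 f) = pder (k + 1) l f := by
  have hf' := contDiff_pder_one_zero hf
  induction l with
  | zero =>
    induction k with
    | zero => rw [pder_zero_zero]
    | succ k ih => rw [pder_succ_left, ih, ← pder_succ_left]
  | succ l ih => rw [pder_succ_right hf', ih, ← pder_succ_right hf]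

lemma pder_pder_zero_one {f : ℝ × ℝ → ℝ} (hf : ContDiff ℝ (⊤ : ℕ∞) f) (k l : ℕ) :
    pder k l (pder 0 1 f) = pder k (l + 1) f := by
  have hf' := contDiff_pder_zero_one hf
  induction k with
  | zero =>
    induction l with
    | zero => rw [pder_zero_zero]
    | succ l ih => rw [pder_succ_right hf', ih, ← pder_succ_right hf]
  | succ k ih => rw [pder_succ_left, ih, ← pder_succ_left]

lemma hasDerivAt_pder_fst {f : ℝ × ℝ → ℝ} (hf : ContDiff ℝ (⊤ : ℕ∞) f) (k l : ℕ) (t y : ℝ) :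
    HasDerivAt (fun t => pder k l f (t, y)) (pder (k + 1) l f (t, y)) t := by
  have hd : Differentiable ℝ (pder k l f) := (contDiff_pder hf k l).differentiable (by simp)
  rw [pder_succ_left, pder_one_zero_eq_fderiv hd]
  exact hasDerivAt_fst_fderiv hd t y

lemma hasDerivAt_pder_snd {f : ℝ × ℝ → ℝ} (hf : ContDiff ℝ (⊤ : ℕ∞) f) (k l : ℕ) (t y : ℝ) :
    HasDerivAt (fun t => pder k l f (y, t)) (pder k (l + 1) f (y, t)) t := by
  have hd : Differentiable ℝ (pder k l f) := (contDiff_pder hf k l).differentiable (by simp)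
  rw [pder_succ_right hf, pder_zero_one_eq_fderiv hd]
  exact hasDerivAt_snd_fderiv hd t y

/-- Leibniz's rule for mixed partial derivatives. -/
lemma pder_mul {u v : ℝ × ℝ → ℝ} (hu : ContDiff ℝ (⊤ : ℕ∞) u) (hv : ContDiff ℝ (⊤ : ℕ∞) v)
    (a b : ℕ) (p : ℝ × ℝ) :
    pder a b (fun q => u q * v q) p =
      ∑ i ∈ Finset.range (a + 1), ∑ j ∈ Finset.range (b + 1),
        (a.choose i * b.choose j : ℝ) * (pder i j u p * pder (a - i) (b - j) v p) := by
  have sl : ∀ {f : ℝ × ℝ → ℝ}, ContDiff ℝ (⊤ : ℕ∞) f → ∀ (y : ℝ) (n : ℕ),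
      ContDiff ℝ n (fun x => f (x, y)) := fun hf y n =>
    (hf.comp (contDiff_id.prodMk contDiff_const)).of_le (mod_cast le_top)
  have sr : ∀ {f : ℝ × ℝ → ℝ}, ContDiff ℝ (⊤ : ℕ∞) f → ∀ (x : ℝ) (n : ℕ),
      ContDiff ℝ n (fun y => f (x, y)) := fun hf y n =>
    (hf.comp (contDiff_const.prodMk contDiff_id)).of_le (mod_cast le_top)
  have inner : ∀ x₁ : ℝ, iteratedDeriv b (fun x₂ => u (x₁, x₂) * v (x₁, x₂)) p.2 =
      ∑ j ∈ Finset.range (b + 1), (b.choose j : ℝ) *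
        (pder 0 j u (x₁, p.2) * pder 0 (b - j) v (x₁, p.2)) := fun x₁ => by
    rw [iteratedDeriv_fun_mul (sr hu x₁ b).contDiffAt (sr hv x₁ b).contDiffAt]
    simp [pder, mul_assoc]
  have cu := fun j => sl (contDiff_pder hu 0 j) p.2 a
  have cv := fun j => sl (contDiff_pder hv 0 j) p.2 a
  have e : pder a b (fun q => u q * v q) p = iteratedDeriv a
      (fun x₁ => iteratedDeriv b (fun x₂ => u (x₁, x₂) * v (x₁, x₂)) p.2) p.1 := rfl
  simp only [e, inner]
  rw [iteratedDeriv_fun_sum fun j _ =>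
    (contDiff_const.mul ((cu j).mul (cv (b - j)))).contDiffAt, Finset.sum_comm]
  refine Finset.sum_congr rfl fun j _ => ?_
  rw [iteratedDeriv_const_mul _ ((cu j).mul (cv (b - j))).contDiffAt,
    iteratedDeriv_fun_mul (cu j).contDiffAt (cv (b - j)).contDiffAt, Finset.mul_sum]
  refine Finset.sum_congr rfl fun i _ => ?_
  simp only [pder, iteratedDeriv_zero]
  ring

/-- The exponent `2N/i` of the `i`-th derivative in the interpolation between `L^∞` and the
`N`-th derivative in `L²`. -/
noncomputable def interpExponent (N i : ℕ) : ENNReal := (2 * N : ℕ) / (i : ℕ)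

/-- Sum of the `L^p(S)` norms of all partial derivatives of order `i`. -/
noncomputable def derivNorm (S : Set (ℝ × ℝ)) (p : ENNReal) (i : ℕ) (f : ℝ × ℝ → ℝ) : ℝ :=
  ∑ k ∈ Finset.range (i + 1), lpNorm (pder k (i - k) f) p (volume.restrict S)

/-- Sum over `i ≤ j` of the `L^{2N/i}(S)` norms of all partial derivatives of order `i`. -/
noncomputable def interpNorm (S : Set (ℝ × ℝ)) (N j : ℕ) (f : ℝ × ℝ → ℝ) : ℝ :=
  ∑ i ∈ Finset.range (j + 1), derivNorm S (interpExponent N i) i f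

lemma interpExponent_inv (N : ℕ) (hN : N ≠ 0) (i : ℕ) :
    (interpExponent N i)⁻¹ = (i : ENNReal) / (2 * N : ℕ) :=
  ENNReal.inv_div (Or.inr (ENNReal.natCast_ne_top _)) (Or.inr (by simpa using hN))

lemma interpExponent_antitone (N : ℕ) : Antitone (interpExponent N) := fun _ _ h =>
  ENNReal.div_le_div_left (mod_cast h) _

lemma interpExponent_self {N : ℕ} (hN : N ≠ 0) : interpExponent N N = 2 := by
  rw [interpExponent, Nat.cast_mul, ENNReal.mul_div_cancel_right (by simpa using hN)
    (ENNReal.natCast_ne_top N), Nat.cast_ofNat]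

lemma holderTriple_interpExponent {N i j : ℕ} (hN : N ≠ 0) {r : ENNReal}
    (h : r⁻¹ = ((i + j : ℕ) : ENNReal) / (2 * N : ℕ)) :
    ENNReal.HolderTriple (interpExponent N i) (interpExponent N j) r :=
  ⟨by rw [interpExponent_inv N hN, interpExponent_inv N hN, h, ← ENNReal.add_div, Nat.cast_add]⟩

lemma interpExponent_succ_eq_ofReal (N i : ℕ) :
    interpExponent N (i + 1) = ENNReal.ofReal ((2 * N : ℕ) / (i + 1 : ℕ)) := by
  rw [ENNReal.ofReal_div_of_pos (by positivity), ENNReal.ofReal_natCast, ENNReal.ofReal_natCast,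
    interpExponent]

lemma derivNorm_nonneg (S : Set (ℝ × ℝ)) (p : ENNReal) (i : ℕ) (f : ℝ × ℝ → ℝ) :
    0 ≤ derivNorm S p i f := Finset.sum_nonneg fun _ _ => lpNorm_nonneg

lemma lpNorm_pder_le_derivNorm (S : Set (ℝ × ℝ)) (p : ENNReal) (k l : ℕ) (f : ℝ × ℝ → ℝ) :
    lpNorm (pder k l f) p (volume.restrict S) ≤ derivNorm S p (k + l) f := by
  have := Finset.single_le_sum
    (f := fun k' => lpNorm (pder k' (k + l - k') f) p (volume.restrict S))
    (fun _ _ => lpNorm_nonneg) (Finset.mem_range.2 (by omega : k < k + l + 1))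
  rwa [Nat.add_sub_cancel_left] at this

lemma interpNorm_nonneg (S : Set (ℝ × ℝ)) (N j : ℕ) (f : ℝ × ℝ → ℝ) :
    0 ≤ interpNorm S N j f := Finset.sum_nonneg fun _ _ => derivNorm_nonneg _ _ _ _

lemma interpNorm_succ (S : Set (ℝ × ℝ)) (N j : ℕ) (f : ℝ × ℝ → ℝ) :
    interpNorm S N (j + 1) f =
      interpNorm S N j f + derivNorm S (interpExponent N (j + 1)) (j + 1) f :=
  Finset.sum_range_succ _ _

lemma interpNorm_monotone (S : Set (ℝ × ℝ)) (N : ℕ) (f : ℝ × ℝ → ℝ) :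
    Monotone fun j => interpNorm S N j f := monotone_nat_of_le_succ fun j => by
  rw [interpNorm_succ]; exact le_add_of_nonneg_right (derivNorm_nonneg _ _ _ _)

lemma derivNorm_le_interpNorm (S : Set (ℝ × ℝ)) (N j : ℕ) (f : ℝ × ℝ → ℝ) :
    derivNorm S (interpExponent N j) j f ≤ interpNorm S N j f :=
  Finset.single_le_sum (f := fun i => derivNorm S (interpExponent N i) i f)
    (fun _ _ => derivNorm_nonneg _ _ _ _) (Finset.mem_range.2 (Nat.lt_succ_self j))

lemma interpNorm_zero_le {S : Set (ℝ × ℝ)} (hS : MeasurableSet S) {N : ℕ} (hN : N ≠ 0)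
    {f : ℝ × ℝ → ℝ} (hf : Continuous f) {B : ℝ} (hB : 0 ≤ B) (h : ∀ x ∈ S, |f x| ≤ B) :
    interpNorm S N 0 f ≤ B := by
  have htop : interpExponent N 0 = ⊤ := by
    rw [interpExponent, Nat.cast_zero]
    exact ENNReal.div_zero (by simpa using hN)
  simp only [interpNorm, derivNorm, zero_add, Finset.sum_range_one, htop, pder_zero_zero,
    Nat.sub_zero]
  rw [← toReal_eLpNorm hf.aestronglyMeasurable]
  refine ENNReal.toReal_le_of_le_ofReal hB ?_
  have := eLpNorm_le_of_ae_bound (p := ⊤) (μ := volume.restrict S) (f := f) (C := B)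
    (by filter_upwards [ae_restrict_mem hS] with x hx using h x hx)
  simpa using this

lemma exists_lpNorm_pder_sq_le {a b c d : ℝ} (hab : a < b) (hcd : c < d) {N i : ℕ}
    (hi : i + 1 < N) : ∃ C : ℝ, 0 ≤ C ∧ ∀ f : ℝ × ℝ → ℝ, ContDiff ℝ (⊤ : ℕ∞) f →
    ∀ k l, k + l = i + 1 →
    lpNorm (pder k l f) (interpExponent N (i + 1))
      (volume.restrict (Set.Ioo a b ×ˢ Set.Ioo c d)) ^ 2 ≤
      C * (interpNorm (Set.Ioo a b ×ˢ Set.Ioo c d) N i f *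
        interpNorm (Set.Ioo a b ×ˢ Set.Ioo c d) N (i + 2) f) := by
  have hN : N ≠ 0 := by omega
  set S : Set (ℝ × ℝ) := Set.Ioo a b ×ˢ Set.Ioo c d
  set s : ℝ := (2 * N : ℕ) / (i + 1 : ℕ) - 2 with hs
  have hi' : (i + 1 : ℕ) < (N : ℝ) := mod_cast hi
  have hs0 : 0 < s := by
    rw [hs, sub_pos, lt_div_iff₀ (by positivity)]
    push_cast at hi' ⊢
    linarith
  have hp : interpExponent N (i + 1) = ENNReal.ofReal (s + 2) := by
    rw [interpExponent_succ_eq_ofReal, hs, sub_add_cancel]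
  have hr : 1 ≤ interpExponent N (i + 2) := by
    refine le_trans ?_ (interpExponent_antitone N (by omega : i + 2 ≤ N))
    rw [interpExponent_self hN]; exact one_le_two
  have hrp : interpExponent N (i + 2) ≤ ENNReal.ofReal (s + 2) :=
    hp ▸ interpExponent_antitone N (by omega : i + 1 ≤ i + 2)
  have hpq : ENNReal.ofReal (s + 2) ≤ interpExponent N i :=
    hp ▸ interpExponent_antitone N (by omega : i ≤ i + 1)
  have : ENNReal.HolderTriple (interpExponent N i) (interpExponent N (i + 2))
      (ENNReal.ofReal ((s + 2) / 2)) := by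
    refine holderTriple_interpExponent hN ?_
    rw [← ENNReal.ofReal_inv_of_pos (by linarith), ← ENNReal.ofReal_natCast,
      ← ENNReal.ofReal_natCast, ← ENNReal.ofReal_div_of_pos (by positivity), hs, sub_add_cancel]
    congr 1
    push_cast
    have : (i : ℝ) + 1 ≠ 0 := by positivity
    field_simp
    ring
  obtain ⟨C₁, hC₁, H₁⟩ := exists_lpNorm_fst_deriv_sq_le (c := c) (d := d) hs0 hab
    (interpExponent N i) (interpExponent N (i + 2)) hr hrp hpq
  obtain ⟨C₂, hC₂, H₂⟩ := exists_lpNorm_snd_deriv_sq_le (a := a) (b := b) hs0 hcd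
    (interpExponent N i) (interpExponent N (i + 2)) hr hrp hpq
  rw [← hp] at H₁ H₂
  refine ⟨C₁ + C₂, by positivity, fun f hf k l hkl => ?_⟩
  have cf := fun k l => (contDiff_pder hf k l).continuous
  have bound : ∀ x y z : ℝ, 0 ≤ x → x ≤ derivNorm S (interpExponent N i) i f →
      y ≤ derivNorm S (interpExponent N (i + 1)) (i + 1) f →
      z ≤ derivNorm S (interpExponent N (i + 2)) (i + 2) f →
      x * (x + y + z) ≤ interpNorm S N i f * interpNorm S N (i + 2) f := fun x y z hx0 hx hy hz => by
    have h0 := derivNorm_le_interpNorm S N i f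
    have h2 := interpNorm_succ S N (i + 1) f
    rw [interpNorm_succ S N i f] at h2
    exact mul_le_mul_of_nonneg (hx.trans h0) (by linarith) hx0 (interpNorm_nonneg _ _ _ _)
  have hI : 0 ≤ interpNorm S N i f * interpNorm S N (i + 2) f :=
    mul_nonneg (interpNorm_nonneg _ _ _ _) (interpNorm_nonneg _ _ _ _)
  rcases k with _ | k
  · obtain rfl : l = i + 1 := by omega
    have e0 := lpNorm_pder_le_derivNorm S (interpExponent N i) 0 i f
    have e1 := lpNorm_pder_le_derivNorm S (interpExponent N (i + 1)) 0 (i + 1) f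
    have e2 := lpNorm_pder_le_derivNorm S (interpExponent N (i + 2)) 0 (i + 2) f
    rw [zero_add] at e0 e1 e2
    refine (H₂ _ _ _ (cf 0 i) (cf 0 (i + 1)) (cf 0 (i + 2)) (hasDerivAt_pder_snd hf 0 i)
      (hasDerivAt_pder_snd hf 0 (i + 1))).trans ?_
    exact mul_le_mul (by linarith) (bound _ _ _ lpNorm_nonneg e0 e1 e2)
      (mul_nonneg lpNorm_nonneg
        (add_nonneg (add_nonneg lpNorm_nonneg lpNorm_nonneg) lpNorm_nonneg)) (by positivity)
  · obtain rfl : i = k + l := by omega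
    have e0 := lpNorm_pder_le_derivNorm S (interpExponent N (k + l)) k l f
    have e1 := lpNorm_pder_le_derivNorm S (interpExponent N (k + l + 1)) (k + 1) l f
    have e2 := lpNorm_pder_le_derivNorm S (interpExponent N (k + l + 2)) (k + 2) l f
    rw [show k + 1 + l = k + l + 1 by omega] at e1
    rw [show k + 2 + l = k + l + 2 by omega] at e2
    refine (H₁ _ _ _ (cf k l) (cf (k + 1) l) (cf (k + 2) l) (hasDerivAt_pder_fst hf k l)
      (hasDerivAt_pder_fst hf (k + 1) l)).trans ?_
    exact mul_le_mul (by linarith) (bound _ _ _ lpNorm_nonneg e0 e1 e2)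
      (mul_nonneg lpNorm_nonneg
        (add_nonneg (add_nonneg lpNorm_nonneg lpNorm_nonneg) lpNorm_nonneg)) (by positivity)

lemma exists_interpNorm_sq_le {a b c d : ℝ} (hab : a < b) (hcd : c < d) (N : ℕ) :
    ∃ C : ℝ, 0 ≤ C ∧ ∀ f : ℝ × ℝ → ℝ, ContDiff ℝ (⊤ : ℕ∞) f → ∀ i, i + 1 < N →
    interpNorm (Set.Ioo a b ×ˢ Set.Ioo c d) N (i + 1) f ^ 2 ≤
      C * interpNorm (Set.Ioo a b ×ˢ Set.Ioo c d) N i f *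
        interpNorm (Set.Ioo a b ×ˢ Set.Ioo c d) N (i + 2) f := by
  set S : Set (ℝ × ℝ) := Set.Ioo a b ×ˢ Set.Ioo c d
  have single : ∀ i, ∃ C : ℝ, 0 ≤ C ∧ (i + 1 < N → ∀ f : ℝ × ℝ → ℝ, ContDiff ℝ (⊤ : ℕ∞) f →
      interpNorm S N (i + 1) f ^ 2 ≤ C * (interpNorm S N i f * interpNorm S N (i + 2) f)) := by
    intro i
    by_cases hi : i + 1 < N
    swap
    · exact ⟨0, le_rfl, fun h => absurd h hi⟩
    obtain ⟨C, hC, H⟩ := exists_lpNorm_pder_sq_le hab hcd hi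
    refine ⟨2 + 2 * ((i + 2) * ((i + 2) * C)), by positivity, fun _ f hf => ?_⟩
    have h0 := interpNorm_nonneg S N i f
    have h02 : interpNorm S N i f ≤ interpNorm S N (i + 2) f :=
      interpNorm_monotone S N f (by omega)
    have hD : derivNorm S (interpExponent N (i + 1)) (i + 1) f ^ 2 ≤
        (i + 2) * ((i + 2) * (C * (interpNorm S N i f * interpNorm S N (i + 2) f))) := by
      have h1 := sq_sum_le_card_mul_sum_sq (s := Finset.range (i + 1 + 1))
        (f := fun k => lpNorm (pder k (i + 1 - k) f) (interpExponent N (i + 1))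
          (volume.restrict S))
      have h2 := Finset.sum_le_card_nsmul (Finset.range (i + 1 + 1))
        (fun k => lpNorm (pder k (i + 1 - k) f) (interpExponent N (i + 1))
          (volume.restrict S) ^ 2) _
        fun k hk => H f hf k (i + 1 - k) (by have := Finset.mem_range.1 hk; omega)
      rw [Finset.card_range, nsmul_eq_mul] at h2
      rw [Finset.card_range] at h1
      refine h1.trans ?_
      have e : ((i + 1 + 1 : ℕ) : ℝ) = i + 2 := by push_cast; ring
      rw [e] at h2 ⊢
      gcongr
    rw [interpNorm_succ]
    nlinarith [sq_nonneg (interpNorm S N i f - derivNorm S (interpExponent N (i + 1)) (i + 1) f),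
      mul_le_mul_of_nonneg_left h02 h0]
  choose C hC H using single
  refine ⟨∑ i ∈ Finset.range N, C i, Finset.sum_nonneg fun i _ => hC i, fun f hf i hi => ?_⟩
  rw [mul_assoc]
  refine (H i hi f hf).trans (mul_le_mul_of_nonneg_right ?_
    (mul_nonneg (interpNorm_nonneg _ _ _ _) (interpNorm_nonneg _ _ _ _)))
  exact Finset.single_le_sum (fun i _ => hC i) (Finset.mem_range.2 (by omega))

lemma mul_le_of_pow_le_mul_pow {N i j : ℕ} (hN : N ≠ 0) (hij : i + j = N)
    {x y f₀ f₁ g₀ g₁ K L : ℝ} (hy : 0 ≤ y) (hf₀ : 0 ≤ f₀) (hf₁ : 0 ≤ f₁)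
    (hg₀ : 0 ≤ g₀) (hg₁ : 0 ≤ g₁) (hK : 0 ≤ K) (hx' : x ^ N ≤ K * f₀ ^ j * f₁ ^ i)
    (hy' : y ^ N ≤ L * g₀ ^ i * g₁ ^ j) :
    x * y ≤ max 1 (K * L) * (f₀ * g₁ + f₁ * g₀) := by
  refine le_of_pow_le_pow_left₀ hN (by positivity) ?_
  calc (x * y) ^ N = x ^ N * y ^ N := mul_pow _ _ _
    _ ≤ (K * f₀ ^ j * f₁ ^ i) * (L * g₀ ^ i * g₁ ^ j) := by gcongr
    _ = (K * L) * ((f₀ * g₁) ^ j * (f₁ * g₀) ^ i) := by rw [mul_pow, mul_pow]; ring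
    _ ≤ (max 1 (K * L)) ^ N *
        ((f₀ * g₁ + f₁ * g₀) ^ j * (f₀ * g₁ + f₁ * g₀) ^ i) := by
        gcongr
        · exact (le_max_right _ _).trans (le_self_pow₀ (le_max_left _ _) hN)
        · exact le_add_of_nonneg_right (by positivity)
        · exact le_add_of_nonneg_left (by positivity)
    _ = _ := by rw [← pow_add, add_comm j, hij, mul_pow]

/-- Interpolated product estimate. -/
lemma exists_interpNorm_mul_le {a b c d : ℝ} (hab : a < b) (hcd : c < d) {N i j : ℕ}
    (hN : N ≠ 0) (hij : i + j = N) :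
    ∃ K : ℝ, 0 ≤ K ∧ ∀ f g : ℝ × ℝ → ℝ, ContDiff ℝ (⊤ : ℕ∞) f → ContDiff ℝ (⊤ : ℕ∞) g →
    interpNorm (Set.Ioo a b ×ˢ Set.Ioo c d) N i f * interpNorm (Set.Ioo a b ×ˢ Set.Ioo c d) N j g ≤
      K * (interpNorm (Set.Ioo a b ×ˢ Set.Ioo c d) N 0 f *
          interpNorm (Set.Ioo a b ×ˢ Set.Ioo c d) N N g +
        interpNorm (Set.Ioo a b ×ˢ Set.Ioo c d) N N f *
          interpNorm (Set.Ioo a b ×ˢ Set.Ioo c d) N 0 g) := by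
  set S : Set (ℝ × ℝ) := Set.Ioo a b ×ˢ Set.Ioo c d
  obtain ⟨C, hC, H⟩ := exists_interpNorm_sq_le hab hcd N
  obtain ⟨K₁, hK₁, H₁⟩ := logConvex_interp C hC N j
  obtain ⟨K₂, -, H₂⟩ := logConvex_interp C hC N i
  refine ⟨max 1 (K₁ * K₂), by positivity, fun f g hf hg => ?_⟩
  exact mul_le_of_pow_le_mul_pow hN hij (interpNorm_nonneg _ _ _ _) (interpNorm_nonneg _ _ _ _)
    (interpNorm_nonneg _ _ _ _) (interpNorm_nonneg _ _ _ _) (interpNorm_nonneg _ _ _ _) hK₁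
    (H₁ (fun i => interpNorm S N i f) i (fun _ => interpNorm_nonneg _ _ _ _) (H f hf) hij)
    (H₂ (fun i => interpNorm S N i g) j (fun _ => interpNorm_nonneg _ _ _ _) (H g hg) (by omega))

lemma exists_interpNorm_self_le {a b c d : ℝ} (hab : a < b) (hcd : c < d) {N : ℕ} (hN : N ≠ 0) :
    ∃ K : ℝ, 0 ≤ K ∧ ∀ f : ℝ × ℝ → ℝ, ContDiff ℝ (⊤ : ℕ∞) f →
    interpNorm (Set.Ioo a b ×ˢ Set.Ioo c d) N N f ≤
      K * (interpNorm (Set.Ioo a b ×ˢ Set.Ioo c d) N 0 f +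
        derivNorm (Set.Ioo a b ×ˢ Set.Ioo c d) 2 N f) := by
  set S : Set (ℝ × ℝ) := Set.Ioo a b ×ˢ Set.Ioo c d
  obtain ⟨C, hC, H⟩ := exists_interpNorm_sq_le hab hcd N
  obtain ⟨n, rfl⟩ := Nat.exists_eq_succ_of_ne_zero hN
  obtain ⟨K, hK, HK⟩ := logConvex_last C hC n
  refine ⟨K, hK, fun f hf => ?_⟩
  have := HK (fun i => interpNorm S (n + 1) i f) (fun _ => interpNorm_nonneg _ _ _ _)
    (interpNorm_monotone S _ f) (fun i hi => H f hf i hi)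
  rwa [interpNorm_succ, add_sub_cancel_left, ← interpNorm_succ, interpExponent_self hN] at this

lemma sqrt_integral_channelD_eq_lpNorm {f : ℝ × ℝ → ℝ} (hf : Continuous f) :
    Real.sqrt (∫ p in channelD, f p ^ 2) =
      lpNorm f 2 (volume.restrict (Set.Ioo 0 (2 * π) ×ˢ Set.Ioo (-1) 1)) := by
  have e : (channelD : Set (ℝ × ℝ)) =ᵐ[volume]
      (Set.Ioo 0 (2 * π) ×ˢ Set.Ioo (-1) 1 : Set (ℝ × ℝ)) :=
    Measure.set_prod_ae_eq Ioo_ae_eq_Ioc.symm (ae_eq_refl _)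
  rw [Measure.restrict_congr_set e]
  have h2 := lpNorm_rpow_eq_integral (S := Set.Ioo 0 (2 * π) ×ˢ Set.Ioo (-1 : ℝ) 1) hf
    (two_pos : (0 : ℝ) < 2)
  simp only [ENNReal.ofReal_ofNat, Real.rpow_ofNat, sq_abs] at h2
  rw [← h2, Real.sqrt_sq lpNorm_nonneg]

/-- A derivative of `u` of positive order, seen as a derivative of a first-order derivative. -/
lemma exists_pder_eq_pder {u : ℝ × ℝ → ℝ} (hu : ContDiff ℝ (⊤ : ℕ∞) u) {i j n : ℕ}
    (h : i + j = n + 1) (S : Set (ℝ × ℝ)) : ∃ w : ℝ × ℝ → ℝ, ∃ i' j', i' + j' = n ∧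
    ContDiff ℝ (⊤ : ℕ∞) w ∧ (w = pder 1 0 u ∨ w = pder 0 1 u) ∧ pder i j u = pder i' j' w ∧
    ∀ N, derivNorm S 2 N w ≤ derivNorm S 2 (N + 1) u := by
  rcases i with _ | i
  · obtain rfl : j = n + 1 := by omega
    refine ⟨pder 0 1 u, 0, n, zero_add n, contDiff_pder_zero_one hu, Or.inr rfl,
      (pder_pder_zero_one hu 0 n).symm, fun N => ?_⟩
    rw [derivNorm, derivNorm, Finset.sum_range_succ _ (N + 1)]
    refine le_add_of_le_of_nonneg (Finset.sum_le_sum fun k hk => ?_) lpNorm_nonneg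
    have := Finset.mem_range.1 hk
    rw [pder_pder_zero_one hu, show N - k + 1 = N + 1 - k by omega]
  · refine ⟨pder 1 0 u, i, j, by omega, contDiff_pder_one_zero hu, Or.inl rfl,
      (pder_pder_one_zero hu i j).symm, fun N => ?_⟩
    rw [derivNorm, derivNorm, Finset.sum_range_succ' _ (N + 1)]
    refine le_add_of_le_of_nonneg (Finset.sum_le_sum fun k hk => ?_) lpNorm_nonneg
    rw [pder_pder_one_zero hu, Nat.add_sub_add_right]

lemma exists_lpNorm_pder_mul_le {a b c d : ℝ} (hab : a < b) (hcd : c < d) {m i j k l : ℕ}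
    (hij : 1 ≤ i + j) (hm : i + j + (k + l) = m) : ∃ K : ℝ, 0 ≤ K ∧
    ∀ u v : ℝ × ℝ → ℝ, ContDiff ℝ (⊤ : ℕ∞) u → ContDiff ℝ (⊤ : ℕ∞) v →
    ∀ A B : ℝ, 0 ≤ A → 0 ≤ B →
    (∀ p ∈ Set.Ioo a b ×ˢ Set.Ioo c d, |pder 1 0 u p| ≤ A ∧ |pder 0 1 u p| ≤ A) →
    (∀ p ∈ Set.Ioo a b ×ˢ Set.Ioo c d, |v p| ≤ B) →
    lpNorm (fun p => pder i j u p * pder k l v p) 2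
        (volume.restrict (Set.Ioo a b ×ˢ Set.Ioo c d)) ≤
      K * (A * derivNorm (Set.Ioo a b ×ˢ Set.Ioo c d) 2 (m - 1) v +
        derivNorm (Set.Ioo a b ×ˢ Set.Ioo c d) 2 m u * B + A * B) := by
  set S : Set (ℝ × ℝ) := Set.Ioo a b ×ˢ Set.Ioo c d
  have hS : Bornology.IsBounded S := (Metric.isBounded_Ioo _ _).prod (Metric.isBounded_Ioo _ _)
  have hSm : MeasurableSet S := measurableSet_Ioo.prod measurableSet_Ioo
  obtain ⟨n, hn⟩ : ∃ n, i + j = n + 1 := ⟨i + j - 1, by omega⟩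
  rcases Nat.eq_zero_or_pos n with rfl | hn0
  · refine ⟨1, zero_le_one, fun u v hu hv A B hA hB hDu _ => ?_⟩
    have cv := (contDiff_pder hv k l).continuous
    have cu := (contDiff_pder hu i j).continuous
    have hu' : ∀ p ∈ S, |pder i j u p| ≤ A := fun p hp => by
      obtain ⟨rfl, rfl⟩ | ⟨rfl, rfl⟩ : (i = 1 ∧ j = 0) ∨ (i = 0 ∧ j = 1) := by omega
      · exact (hDu p hp).1
      · exact (hDu p hp).2
    have h1 := lpNorm_le_mul_of_abs_le hS hSm (cu.mul cv) cv hA (fun p hp => by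
      rw [Pi.mul_apply, abs_mul]; exact mul_le_mul_of_nonneg_right (hu' p hp) (abs_nonneg _)) 2
    have h2 := lpNorm_pder_le_derivNorm S 2 k l v
    rw [show k + l = m - 1 by omega] at h2
    have h3 := derivNorm_nonneg S 2 m u
    have h4 := mul_le_mul_of_nonneg_left h2 hA
    rw [one_mul]
    exact (h1.trans h4).trans (by rw [add_assoc]; exact le_add_of_nonneg_right (by positivity))
  · obtain ⟨N, rfl⟩ : ∃ N, m = N + 1 := ⟨m - 1, by omega⟩
    have hN : N ≠ 0 := by omega
    have hnN : n + (k + l) = N := by omega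
    obtain ⟨K, hK, H⟩ := exists_interpNorm_mul_le hab hcd hN hnN
    obtain ⟨L, hL, HL⟩ := exists_interpNorm_self_le hab hcd hN
    refine ⟨K * (2 * L), by positivity, fun u v hu hv A B hA hB hDu hvB => ?_⟩
    obtain ⟨w, i', j', hi'j', hw, hwu, hpw, hwN⟩ := exists_pder_eq_pder hu hn S
    have hwA : ∀ p ∈ S, |w p| ≤ A := by
      rcases hwu with rfl | rfl
      · exact fun p hp => (hDu p hp).1
      · exact fun p hp => (hDu p hp).2
    have w0 := interpNorm_zero_le hSm hN hw.continuous hA hwA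
    have v0 := interpNorm_zero_le hSm hN hv.continuous hB hvB
    have : ENNReal.HolderTriple (interpExponent N n) (interpExponent N (k + l)) 2 := by
      refine holderTriple_interpExponent hN ?_
      rw [hnN, ← interpExponent_inv N hN, interpExponent_self hN]
    have h1 := lpNorm_mul_le_of_holder hS hSm (contDiff_pder hw i' j').continuous
      (contDiff_pder hv k l).continuous (interpExponent N n) (interpExponent N (k + l)) 2
    have h2 := (lpNorm_pder_le_derivNorm S (interpExponent N n) i' j' w)
    rw [hi'j'] at h2
    have h3 := lpNorm_pder_le_derivNorm S (interpExponent N (k + l)) k l v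
    have wN := (HL w hw).trans (mul_le_mul_of_nonneg_left (add_le_add w0 (hwN N)) hL)
    have vN := (HL v hv).trans (mul_le_mul_of_nonneg_left (add_le_add_left v0 _) hL)
    have U0 := derivNorm_nonneg S 2 (N + 1) u
    have V0 := derivNorm_nonneg S 2 N v
    rw [hpw, Nat.add_sub_cancel]
    calc _ ≤ interpNorm S N n w * interpNorm S N (k + l) v :=
          h1.trans (mul_le_mul (h2.trans (derivNorm_le_interpNorm _ _ _ _))
            (h3.trans (derivNorm_le_interpNorm _ _ _ _)) lpNorm_nonneg (interpNorm_nonneg _ _ _ _))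
      _ ≤ K * (interpNorm S N 0 w * interpNorm S N N v +
          interpNorm S N N w * interpNorm S N 0 v) := H w v hw hv
      _ ≤ K * (A * (L * (B + derivNorm S 2 N v)) + L * (A + derivNorm S 2 (N + 1) u) * B) := by
        refine mul_le_mul_of_nonneg_left (add_le_add ?_ ?_) hK
        · exact mul_le_mul w0 vN (interpNorm_nonneg _ _ _ _) hA
        · exact mul_le_mul wN v0 (interpNorm_nonneg _ _ _ _) (by positivity)
      _ ≤ _ := by
        rw [mul_assoc K]
        refine mul_le_mul_of_nonneg_left ?_ hK
        nlinarith [mul_nonneg hL (mul_nonneg hA V0), mul_nonneg hL (mul_nonneg U0 hB)]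

lemma exists_lpNorm_commutator_le {a b c d : ℝ} (hab : a < b) (hcd : c < d) (m α₁ α₂ : ℕ) :
    ∃ K : ℝ, 0 ≤ K ∧ (α₁ + α₂ = m →
    ∀ u v : ℝ × ℝ → ℝ, ContDiff ℝ (⊤ : ℕ∞) u → ContDiff ℝ (⊤ : ℕ∞) v →
    ∀ A B : ℝ, 0 ≤ A → 0 ≤ B →
    (∀ p ∈ Set.Ioo a b ×ˢ Set.Ioo c d, |pder 1 0 u p| ≤ A ∧ |pder 0 1 u p| ≤ A) →
    (∀ p ∈ Set.Ioo a b ×ˢ Set.Ioo c d, |v p| ≤ B) →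
    lpNorm (fun p => pder α₁ α₂ (fun q => u q * v q) p - u p * pder α₁ α₂ v p) 2
        (volume.restrict (Set.Ioo a b ×ˢ Set.Ioo c d)) ≤
      K * (A * derivNorm (Set.Ioo a b ×ˢ Set.Ioo c d) 2 (m - 1) v +
        derivNorm (Set.Ioo a b ×ˢ Set.Ioo c d) 2 m u * B + A * B)) := by
  by_cases hα : α₁ + α₂ = m
  swap
  · exact ⟨0, le_rfl, fun h => absurd h hα⟩
  set S : Set (ℝ × ℝ) := Set.Ioo a b ×ˢ Set.Ioo c d
  have hS : Bornology.IsBounded S := (Metric.isBounded_Ioo _ _).prod (Metric.isBounded_Ioo _ _)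
  have hSm : MeasurableSet S := measurableSet_Ioo.prod measurableSet_Ioo
  set I : Finset (ℕ × ℕ) := (Finset.range (α₁ + 1) ×ˢ Finset.range (α₂ + 1)).erase (0, 0) with hI
  have hmem : ∀ x ∈ I, 1 ≤ x.1 + x.2 ∧ x.1 + x.2 + (α₁ - x.1 + (α₂ - x.2)) = m := by
    rintro ⟨i, j⟩ hx
    simp only [hI, Finset.mem_erase, ne_eq, Prod.mk.injEq, Finset.mem_product,
      Finset.mem_range] at hx ⊢
    omega
  choose! K hK H using fun (x : ℕ × ℕ) (hx : x ∈ I) =>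
    exists_lpNorm_pder_mul_le hab hcd (hmem x hx).1 (hmem x hx).2
  refine ⟨∑ x ∈ I, (α₁.choose x.1 * α₂.choose x.2 : ℝ) * K x,
    Finset.sum_nonneg fun x hx => mul_nonneg (by positivity) (hK x hx), ?_⟩
  intro _ u v hu hv A B hA hB hDu hvB
  have e : (fun p => pder α₁ α₂ (fun q => u q * v q) p - u p * pder α₁ α₂ v p) =
      ∑ x ∈ I, (α₁.choose x.1 * α₂.choose x.2 : ℝ) •
        fun p => pder x.1 x.2 u p * pder (α₁ - x.1) (α₂ - x.2) v p := by
    funext p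
    rw [pder_mul hu hv, ← Finset.sum_product', hI, Finset.sum_apply, Finset.sum_erase_eq_sub]
    · simp [pder_zero_zero]
    · simp
  rw [e, Finset.sum_mul]
  refine (lpNorm_sum_le (fun x _ => (memLp_of_continuous_bounded hS hSm
    ((contDiff_pder hu _ _).continuous.mul (contDiff_pder hv _ _).continuous) 2).const_smul _)
    one_le_two).trans (Finset.sum_le_sum fun x hx => ?_)
  rw [lpNorm_const_smul, mul_assoc, coe_nnnorm, Real.norm_of_nonneg (by positivity)]
  exact mul_le_mul_of_nonneg_left (H x hx u v hu hv A B hA hB hDu hvB) (by positivity)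

/-- Commutator estimate on the channel `D = 𝕋 × (-1,1)`: for every `m ≥ 1` there is
`C = C(m)` such that for all (smooth, `2π`-periodic in `x₁`) `u, v` and every
multi-index `α` of length `m`,
`‖∂^α(uv) - u ∂^α v‖_{L²} ≤ C(‖Du‖_∞ ‖∂^{m-1}v‖_{L²} + ‖∂^m u‖_{L²} ‖v‖_∞ + ‖Du‖_∞ ‖v‖_∞)`. -/
theorem commutator_estimate_channel (m : ℕ) (hm : 1 ≤ m) :
    ∃ C : ℝ, 0 < C ∧
      ∀ u v : ℝ × ℝ → ℝ,
        ContDiff ℝ (⊤ : ℕ∞) u → ContDiff ℝ (⊤ : ℕ∞) v →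
        (∀ p : ℝ × ℝ, u (p.1 + 2 * Real.pi, p.2) = u p) →
        (∀ p : ℝ × ℝ, v (p.1 + 2 * Real.pi, p.2) = v p) →
        ∀ α₁ α₂ : ℕ, α₁ + α₂ = m →
        ∀ A Mv : ℝ,
          (∀ p ∈ channelD, |pder 1 0 u p| ≤ A ∧ |pder 0 1 u p| ≤ A) →
          (∀ p ∈ channelD, |v p| ≤ Mv) →
          Real.sqrt (∫ p in channelD,
              (pder α₁ α₂ (fun q => u q * v q) p - u p * pder α₁ α₂ v p) ^ 2)
            ≤ C * (A * ∑ k ∈ Finset.range m,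
                    Real.sqrt (∫ p in channelD, (pder k (m - 1 - k) v p) ^ 2)
                + (∑ k ∈ Finset.range (m + 1),
                    Real.sqrt (∫ p in channelD, (pder k (m - k) u p) ^ 2)) * Mv
                + A * Mv) := by
  choose K hK H using fun k : ℕ =>
    exists_lpNorm_commutator_le two_pi_pos (neg_one_lt_zero.trans one_pos) m k (m - k)
  refine ⟨1 + ∑ k ∈ Finset.range (m + 1), K k,
    add_pos_of_pos_of_nonneg one_pos (Finset.sum_nonneg fun k _ => hK k), ?_⟩
  intro u v hu hv _ _ α₁ α₂ hα A B hDu hvB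
  have hsub : Set.Ioo 0 (2 * π) ×ˢ Set.Ioo (-1 : ℝ) 1 ⊆ channelD :=
    Set.prod_mono_left Set.Ioo_subset_Ioc_self
  have hne : ((π, 0) : ℝ × ℝ) ∈ channelD :=
    hsub ⟨⟨pi_pos, by linarith [pi_pos]⟩, by norm_num, by norm_num⟩
  have hA : 0 ≤ A := (abs_nonneg _).trans (hDu _ hne).1
  have hB : 0 ≤ B := (abs_nonneg _).trans (hvB _ hne)
  have cu := fun k l => (contDiff_pder hu k l).continuous
  have cv := fun k l => (contDiff_pder hv k l).continuous
  obtain rfl : α₂ = m - α₁ := by omega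
  have key := H α₁ (by omega) u v hu hv A B hA hB (fun p hp => hDu p (hsub hp))
    (fun p hp => hvB p (hsub hp))
  rw [derivNorm, derivNorm, Nat.sub_add_cancel hm] at key
  have cF : Continuous fun p =>
      pder α₁ (m - α₁) (fun q => u q * v q) p - u p * pder α₁ (m - α₁) v p :=
    (contDiff_pder (hu.mul hv) _ _).continuous.sub (hu.continuous.mul (cv _ _))
  rw [sqrt_integral_channelD_eq_lpNorm cF]
  simp only [sqrt_integral_channelD_eq_lpNorm (cu _ _), sqrt_integral_channelD_eq_lpNorm (cv _ _)]
  refine key.trans (mul_le_mul_of_nonneg_right ?_ ?_)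
  · exact (Finset.single_le_sum (fun k _ => hK k) (Finset.mem_range.2 (by omega))).trans
      (le_add_of_nonneg_left zero_le_one)
  · have hV : ∀ (s : Finset ℕ) (F : ℕ → ℝ × ℝ → ℝ), 0 ≤ ∑ k ∈ s, lpNorm (F k) 2
        (volume.restrict (Set.Ioo 0 (2 * π) ×ˢ Set.Ioo (-1 : ℝ) 1)) :=
      fun s F => Finset.sum_nonneg fun _ _ => lpNorm_nonneg
    exact add_nonneg (add_nonneg (mul_nonneg hA (hV _ _)) (mul_nonneg (hV _ _) hB))
      (mul_nonneg hA hB)
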